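/- arXiv:2512.14262 — 4 statements merged into one kernel-verified Lean document; each statement's English description precedes it below -/
import Mathlib

section
/- The second group cohomology of the alternating group with trivial integer coefficients satisfies H^2(𝔄_3, ℤ_triv) ≅ ℤ/3ℤ and H^2(𝔄_4, ℤ_triv) ≅ ℤ/3ℤ. -/
open CategoryTheory

noncomputable section

/-- The alternating group `𝔄ₙ` on `{1, …, n}`. -/
abbrev Alt (n : ℕ) : Type := alternatingGroup (Fin n)

open groupCohomology in
theorem aux_cocycle {G : Type} [Group G] (f : cocycles₂ (Rep.trivial ℤ G ℤ)) (g h j : G) :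
    (f.1 (g * h, j) : ℤ) + f.1 (g, h) = f.1 (h, j) + f.1 (g, h * j) :=
  (mem_cocycles₂_iff (A := Rep.trivial ℤ G ℤ) f.1).1 f.2 g h j

/-- The sum of a cochain over the second variable. -/
def sumSnd {G : Type} [Fintype G] (f : G × G → ℤ) (g : G) : ℤ := ∑ h, f (g, h)

open groupCohomology in
theorem aux_sum {G : Type} [Group G] [Fintype G] (f : cocycles₂ (Rep.trivial ℤ G ℤ)) (g h : G) :
    sumSnd f.1 (g * h) + (Fintype.card G : ℤ) * f.1 (g, h) = sumSnd f.1 g + sumSnd f.1 h := by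
  have h1 := Finset.sum_congr (rfl : (Finset.univ : Finset G) = Finset.univ)
    (fun j _ => aux_cocycle f g h j)
  rw [Finset.sum_add_distrib, Finset.sum_add_distrib] at h1
  have h2 : ∑ j, (f.1 (g, h * j) : ℤ) = ∑ j, (f.1 (g, j) : ℤ) :=
    Equiv.sum_comp (Equiv.mulLeft h) (fun j => (f.1 (g, j) : ℤ))
  rw [h2, Finset.sum_const, Finset.card_univ, nsmul_eq_mul] at h1
  unfold sumSnd
  linarith

open groupCohomology in
/-- From cocycles to characters. -/
def toChar (G : Type) [Group G] [Fintype G] :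
    cocycles₂ (Rep.trivial ℤ G ℤ) →+ (Additive G →+ ZMod (Fintype.card G)) :=
  AddMonoidHom.mk' (fun f => AddMonoidHom.mk' (fun g => ((sumSnd f.1 g.toMul : ℤ) : ZMod _))
    (by
      intro a b
      have := congrArg (Int.cast : ℤ → ZMod (Fintype.card G)) (aux_sum f a.toMul b.toMul)
      push_cast at this
      simpa using this))
    (by
      intro f f'
      refine DFunLike.ext _ _ fun g => ?_
      have : sumSnd (f + f').1 g.toMul = sumSnd f.1 g.toMul + sumSnd f'.1 g.toMul :=
        Finset.sum_add_distrib
      exact (congrArg (Int.cast : ℤ → ZMod (Fintype.card G)) this).trans (Int.cast_add _ _))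

open groupCohomology in
theorem toChar_apply {G : Type} [Group G] [Fintype G] (f : cocycles₂ (Rep.trivial ℤ G ℤ)) (g : G) :
    toChar G f (Additive.ofMul g) = ((sumSnd f.1 g : ℤ) : ZMod (Fintype.card G)) := rfl

open groupCohomology in
theorem toChar_eq_zero_iff {G : Type} [Group G] [Fintype G] (f : cocycles₂ (Rep.trivial ℤ G ℤ)) :
    toChar G f = 0 ↔ f.1 ∈ coboundaries₂ (Rep.trivial ℤ G ℤ) := by
  have hn : (Fintype.card G : ℤ) ≠ 0 := by exact_mod_cast Fintype.card_ne_zero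
  constructor
  · intro h
    have h1 : ∀ g, ∃ t : ℤ, sumSnd f.1 g = (Fintype.card G : ℤ) * t := by
      intro g
      have := DFunLike.congr_fun h (Additive.ofMul g)
      rw [toChar_apply] at this
      exact (ZMod.intCast_zmod_eq_zero_iff_dvd _ _).1 this
    choose t ht using h1
    refine ⟨t, ?_⟩
    funext ⟨g, h⟩
    have h2 := aux_sum f g h
    rw [ht, ht, ht] at h2
    have h3 : t h - t (g * h) + t g = f.1 (g, h) := by
      apply mul_left_cancel₀ hn
      linarith
    exact h3
  · rintro ⟨t, ht⟩
    refine DFunLike.ext _ _ fun g => ?_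
    have key : sumSnd f.1 g.toMul = (Fintype.card G : ℤ) * t g.toMul := by
      have h1 : ∀ h, (f.1 (g.toMul, h) : ℤ) = t h - t (g.toMul * h) + t g.toMul := by
        intro h
        exact (congrFun ht (g.toMul, h)).symm
      unfold sumSnd
      rw [Finset.sum_congr rfl (fun h _ => h1 h)]
      have h2 : ∑ j, (t (g.toMul * j) : ℤ) = ∑ j, (t j : ℤ) :=
        Equiv.sum_comp (Equiv.mulLeft g.toMul) (fun j => (t j : ℤ))
      erw [Finset.sum_add_distrib, Finset.sum_sub_distrib, h2]
      simp
    have := congrArg (Int.cast : ℤ → ZMod (Fintype.card G)) key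
    push_cast at this
    rw [ZMod.natCast_self, zero_mul] at this
    exact this

open groupCohomology in
theorem toChar_surjective (G : Type) [Group G] [Fintype G] :
    Function.Surjective (toChar G) := by
  intro χ
  have hn : (Fintype.card G : ℤ) ≠ 0 := by exact_mod_cast Fintype.card_ne_zero
  choose s hs using fun g : G => ZMod.intCast_surjective (χ (Additive.ofMul g))
  have h1 : ∀ g h, ∃ t : ℤ, s g + s h - s (g * h) = (Fintype.card G : ℤ) * t := by
    intro g h
    apply (ZMod.intCast_zmod_eq_zero_iff_dvd _ _).1
    push_cast
    rw [hs, hs, hs, ofMul_mul, map_add, sub_self]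
  choose t ht using h1
  have hmem : (fun p : G × G => t p.1 p.2) ∈ cocycles₂ (Rep.trivial ℤ G ℤ) := by
    refine (mem_cocycles₂_iff (A := Rep.trivial ℤ G ℤ) _).2 fun g h j => ?_
    show t (g * h) j + t g h = t h j + t g (h * j)
    apply mul_left_cancel₀ hn
    rw [mul_add, mul_add, ← ht, ← ht, ← ht, ← ht, mul_assoc]
    ring
  refine ⟨⟨_, hmem⟩, ?_⟩
  refine DFunLike.ext _ _ fun g => ?_
  refine Eq.trans (congrArg (Int.cast : ℤ → ZMod (Fintype.card G)) ?_) (hs g.toMul)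
  apply mul_left_cancel₀ hn
  show _ * ∑ h, t g.toMul h = _
  rw [Finset.mul_sum, Finset.sum_congr rfl (fun h _ => (ht g.toMul h).symm)]
  have h2 : ∑ j, s (g.toMul * j) = ∑ j, s j :=
    Equiv.sum_comp (Equiv.mulLeft g.toMul) s
  rw [Finset.sum_sub_distrib, h2, Finset.sum_add_distrib]
  simp

open groupCohomology in
theorem h2_equiv (G : Type) [Group G] [Fintype G] :
    Nonempty (groupCohomology (Rep.trivial ℤ G ℤ) 2 ≃+ (Additive G →+ ZMod (Fintype.card G))) := by
  let p : cocycles₂ (Rep.trivial ℤ G ℤ) →+ groupCohomology (Rep.trivial ℤ G ℤ) 2 :=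
    (H2π (Rep.trivial ℤ G ℤ)).hom.toAddMonoidHom
  have hp : Function.Surjective p :=
    (ModuleCat.epi_iff_surjective (H2π (Rep.trivial ℤ G ℤ))).1 inferInstance
  have hk : p.ker = (toChar G).ker := by
    ext f
    rw [AddMonoidHom.mem_ker, AddMonoidHom.mem_ker, toChar_eq_zero_iff]
    exact H2π_eq_zero_iff f
  exact ⟨(QuotientAddGroup.quotientKerEquivOfSurjective p hp).symm.trans
    ((QuotientAddGroup.quotientAddEquivOfEq hk).trans
      (QuotientAddGroup.quotientKerEquivOfSurjective _ (toChar_surjective G)))⟩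

theorem cyc_equiv {H : Type} [AddCommGroup H] (x : H) (h0 : x ≠ 0) (h3 : 3 • x = 0)
    (hx : ∀ y : H, ∃ k : ℕ, y = k • x) : Nonempty (H ≃+ ZMod 3) := by
  have ho : addOrderOf x = 3 := addOrderOf_eq_prime h3 h0
  have hg : ∀ y : H, y ∈ AddSubgroup.zmultiples x := by
    intro y
    obtain ⟨k, rfl⟩ := hx y
    exact AddSubgroup.nsmul_mem_zmultiples x k
  have hc : Nat.card H = 3 := by
    rw [← ho, addOrderOf_eq_card_of_forall_mem_zmultiples hg]
  have : IsAddCyclic H := ⟨x, hg⟩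
  exact ⟨(hc ▸ (zmodAddCyclicAddEquiv (G := H) inferInstance)).symm⟩

/-- A three-cycle. -/
def cyc3 : Alt 3 := ⟨finRotate 3, Equiv.Perm.mem_alternatingGroup.2 (by decide)⟩

/-- A three-cycle. -/
def cyc4 : Alt 4 :=
  ⟨Equiv.swap 0 1 * Equiv.swap 1 2, Equiv.Perm.mem_alternatingGroup.2 (by decide)⟩

/-- A character. -/
def chr3 (g : Alt 3) : ZMod 3 := if g = 1 then 0 else if g = cyc3 then 1 else 2

/-- A character. -/
def chr4 (g : Alt 4) : ZMod 12 :=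
  if g * g = 1 then 0 else if (g * cyc4⁻¹) * (g * cyc4⁻¹) = 1 then 4 else 8

theorem final_aux {G : Type} [Group G] [Fintype G] (n : ℕ) (hn : Fintype.card G = n) (c : G)
    (χ : G → ZMod n) (hχ : ∀ g h, χ (g * h) = χ g + χ h) (hc0 : χ c ≠ 0) (hc3 : 3 • χ c = 0)
    (hcc : c * c * c = 1) (hz : ∀ z : ZMod n, 3 • z = 0 → ∃ k : ℕ, z = k • χ c)
    (hgen : ∀ g : G, ∃ a b, g = a * b * a⁻¹ * b⁻¹ ∨ g = c * (a * b * a⁻¹ * b⁻¹) ∨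
      g = c * c * (a * b * a⁻¹ * b⁻¹)) :
    Nonempty (groupCohomology (Rep.trivial ℤ G ℤ) 2 ≃+ ZMod 3) := by
  subst hn
  obtain ⟨e⟩ := h2_equiv G
  let x : Additive G →+ ZMod (Fintype.card G) := AddMonoidHom.mk' (fun g => χ g.toMul)
    (fun a b => hχ a.toMul b.toMul)
  have hext : ∀ y z : Additive G →+ ZMod (Fintype.card G),
      y (Additive.ofMul c) = z (Additive.ofMul c) → y = z := by
    intro y z h
    refine DFunLike.ext _ _ fun g => ?_
    obtain ⟨a, b, h1 | h1 | h1⟩ := hgen g.toMul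
    all_goals
      rw [← ofMul_toMul g, h1]
      simp [h]
  have hy3 : ∀ y : Additive G →+ ZMod (Fintype.card G), 3 • y (Additive.ofMul c) = 0 := by
    intro y
    have := congrArg (fun g => y (Additive.ofMul g)) hcc
    simp only [ofMul_mul, map_add, ofMul_one, map_zero] at this
    rw [← this]
    abel
  obtain ⟨e'⟩ := cyc_equiv x
    (fun h => hc0 (DFunLike.congr_fun h (Additive.ofMul c)))
    (hext _ _ hc3)
    (fun y => by
      obtain ⟨k, hk⟩ := hz _ (hy3 y)
      exact ⟨k, hext _ _ hk⟩)
  exact ⟨e.trans e'⟩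

/-- `H²(𝔄₃, ℤ_triv) ≅ ℤ/3ℤ` and `H²(𝔄₄, ℤ_triv) ≅ ℤ/3ℤ`. -/
theorem stmt_1 :
    Nonempty ((groupCohomology (Rep.trivial ℤ (Alt 3) ℤ) 2) ≃+ ZMod 3) ∧
    Nonempty ((groupCohomology (Rep.trivial ℤ (Alt 4) ℤ) 2) ≃+ ZMod 3) := by
  constructor
  · refine final_aux 3 (by decide +kernel) cyc3 chr3 (by decide +kernel) (by decide +kernel)
      (by decide +kernel) (by decide +kernel) ?_ (by decide +kernel)
    have : ∀ z : ZMod 3, 3 • z = 0 → ∃ k : Fin 3, z = (k : ℕ) • chr3 cyc3 := by decide +kernel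
    exact fun z hz => (this z hz).imp' _ fun _ h => h
  · refine final_aux 12 (by decide +kernel) cyc4 chr4 (by decide +kernel) (by decide +kernel)
      (by decide +kernel) (by decide +kernel) ?_ (by decide +kernel)
    have : ∀ z : ZMod 12, 3 • z = 0 → ∃ k : Fin 3, z = (k : ℕ) • chr4 cyc4 := by decide +kernel
    exact fun z hz => (this z hz).imp' _ fun _ h => h
end
end

section
/- For every integer n ≥ 8, the third group cohomology of the alternating group 𝔄_n with coefficients in the trivial module ℤ is H^3(𝔄_n, ℤ_triv) ≅ ℤ/2ℤ. -/
open CategoryTheory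

noncomputable section

open scoped Pointwise in
theorem carm_bound {ι H : Type*} [DecidableEq ι] [Group H] (Y : ι → H)
    (h3 : ∀ i, Y i ^ 3 = 1) (h2 : ∀ i j, i ≠ j → (Y i * Y j) ^ 2 = 1) (I : Finset ι) :
    ((Subgroup.closure (Y '' (I : Set ι)) : Subgroup H) : Set H).Finite ∧
    Set.ncard ((Subgroup.closure (Y '' (I : Set ι)) : Subgroup H) : Set H) * 2
      ≤ (I.card + 2).factorial := by
  classical
  induction I using Finset.induction_on with
  | empty => simp
  | insert l I hl ih =>
    obtain ⟨hf, hc⟩ := ih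
    set K := Subgroup.closure (Y '' (I : Set ι)) with hK
    have hYK : ∀ i ∈ I, Y i ∈ K := fun i hi => Subgroup.subset_closure ⟨i, hi, rfl⟩
    set b := Y l with hb
    have hb3 : b * b * b = 1 := by have := h3 l; rw [pow_succ, pow_two] at this; exact this
    have hbi : b⁻¹ = b * b := by rw [inv_eq_iff_mul_eq_one, ← mul_assoc]; exact hb3
    have ha3 : ∀ i, (Y i)⁻¹ = Y i * Y i := fun i => by
      have := h3 i; rw [pow_succ, pow_two] at this
      rw [inv_eq_iff_mul_eq_one, ← mul_assoc]; exact this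
    have hab : ∀ i j, i ≠ j → Y i * Y j = (Y j)⁻¹ * (Y i)⁻¹ := fun i j hij => by
      have := h2 i j hij; rw [pow_two] at this
      rw [← mul_inv_rev]; exact eq_inv_of_mul_eq_one_left this
    let W : Finset H := {1, b, b⁻¹} ∪ I.image (fun i => Y i * b⁻¹)
    have hWc : W.card ≤ I.card + 3 := by
      refine (Finset.card_union_le _ _).trans ?_
      have := Finset.card_le_three (a := (1:H)) (b := b) (c := b⁻¹)
      have := Finset.card_image_le (s := I) (f := fun i => Y i * b⁻¹)
      omega
    let T : Set H := (W : Set H) * (K : Set H)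
    have hT1 : ∀ k ∈ K, k ∈ T := fun k hk => ⟨1, by simp [W], k, hk, by simp⟩
    have hTb : ∀ k ∈ K, b * k ∈ T := fun k hk => ⟨b, by simp [W], k, hk, by simp⟩
    have hTb' : ∀ k ∈ K, b⁻¹ * k ∈ T := fun k hk => ⟨b⁻¹, by simp [W], k, hk, by simp⟩
    have hTa : ∀ i ∈ I, ∀ k ∈ K, Y i * b⁻¹ * k ∈ T := fun i hi k hk =>
      ⟨Y i * b⁻¹, by
        rw [Finset.mem_coe, Finset.mem_union]; right; exact Finset.mem_image.2 ⟨i, hi, rfl⟩, k, hk, by simp⟩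
    have hne : ∀ i ∈ I, i ≠ l := fun i hi h => hl (h ▸ hi)
    have hTa' : ∀ i ∈ I, ∀ k ∈ K, (Y i)⁻¹ * b * k ∈ T := fun i hi k hk => by
      have : (Y i)⁻¹ * b * k = Y i * b⁻¹ * ((Y i)⁻¹ * k) := by
        rw [ha3, mul_assoc (Y i), hab i l (hne i hi), ← ha3, hb]; group
      rw [this]; exact hTa i hi _ (K.mul_mem (K.inv_mem (hYK i hi)) hk)
    have hcases : ∀ t ∈ T, ∃ k ∈ K, t = k ∨ t = b * k ∨ t = b⁻¹ * k ∨ ∃ i ∈ I, t = Y i * b⁻¹ * k := by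
      rintro t ⟨w, hw, k, hk, rfl⟩
      refine ⟨k, hk, ?_⟩
      rw [Finset.mem_coe, Finset.mem_union, Finset.mem_image] at hw
      simp only [Finset.mem_insert, Finset.mem_singleton] at hw
      rcases hw with (h | h | h) | ⟨i, hi, h⟩
      · left; simp [h]
      · right; left; simp [h]
      · right; right; left; simp [h]
      · right; right; right; exact ⟨i, hi, by simp [← h]⟩
    have hmulb : ∀ t ∈ T, b * t ∈ T := by
      intro t ht
      obtain ⟨k, hk, rfl | rfl | rfl | ⟨i, hi, rfl⟩⟩ := hcases t ht
      · exact hTb _ hk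
      · rw [← mul_assoc, ← hbi]; exact hTb' k hk
      · simpa using hT1 k hk
      · have : b * (Y i * b⁻¹ * k) = (Y i)⁻¹ * b * k := by
          have e : b * Y i = (Y i)⁻¹ * b⁻¹ := hab l i (hne i hi).symm
          have e2 : b⁻¹ * b⁻¹ = b := by
            rw [← mul_inv_rev, ← hbi, inv_inv]
          calc b * (Y i * b⁻¹ * k) = (b * Y i) * b⁻¹ * k := by group
            _ = (Y i)⁻¹ * (b⁻¹ * b⁻¹) * k := by rw [e]; group
            _ = _ := by rw [e2]
        rw [this]; exact hTa' i hi k hk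
    have hmula : ∀ j ∈ I, ∀ t ∈ T, Y j * t ∈ T := by
      intro j hj t ht
      obtain ⟨k, hk, rfl | rfl | rfl | ⟨i, hi, rfl⟩⟩ := hcases t ht
      · exact hT1 _ (K.mul_mem (hYK j hj) hk)
      · have : Y j * (b * k) = b⁻¹ * ((Y j)⁻¹ * k) := by
          rw [← mul_assoc, hab j l (hne j hj), hb]; group
        rw [this]; exact hTb' _ (K.mul_mem (K.inv_mem (hYK j hj)) hk)
      · rw [← mul_assoc]; exact hTa j hj k hk
      · have hbj : (Y j)⁻¹ * b⁻¹ = b * Y j := (hab l j (hne j hj).symm).symm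
        by_cases hij : j = i
        · subst hij
          have : Y j * (Y j * b⁻¹ * k) = b * (Y j * k) := by
            calc _ = (Y j * Y j) * b⁻¹ * k := by group
              _ = _ := by rw [← ha3, hbj]; group
          rw [this]; exact hTb _ (K.mul_mem (hYK j hj) hk)
        · have : Y j * (Y i * b⁻¹ * k) = (Y i)⁻¹ * b * (Y j * k) := by
            calc _ = (Y j * Y i) * b⁻¹ * k := by group
              _ = (Y i)⁻¹ * ((Y j)⁻¹ * b⁻¹) * k := by rw [hab j i hij]; group
              _ = _ := by rw [hbj]; group
          rw [this]; exact hTa' i hi _ (K.mul_mem (hYK j hj) hk)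
    have hsub : ((Subgroup.closure (Y '' ((insert l I : Finset ι) : Set ι)) : Subgroup H) : Set H)
        ⊆ T := by
      intro x hx
      have key : ∀ t ∈ T, x * t ∈ T := by
        induction hx using Subgroup.closure_induction with
        | mem x hx =>
          obtain ⟨i, hi, rfl⟩ := hx
          simp at hi
          rcases hi with rfl | hi
          · exact hmulb
          · exact hmula i hi
        | one => simp
        | mul x y _ _ hx hy => intro t ht; rw [mul_assoc]; exact hx _ (hy _ ht)
        | inv x _ hx => 
          intro t ht
          have hTfin : T.Finite := W.finite_toSet.mul hf
          have him : (fun t => x * t) '' T = T := by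
            apply Set.eq_of_subset_of_ncard_le _ _ hTfin
            · rintro _ ⟨t, ht, rfl⟩; exact hx t ht
            · rw [Set.ncard_image_of_injective _ (mul_right_injective x)]
          rw [← him] at ht
          obtain ⟨u, hu, rfl⟩ := ht
          simpa using hu
      simpa using key 1 (hT1 1 K.one_mem)
    have hTfin : T.Finite := W.finite_toSet.mul hf
    refine ⟨hTfin.subset hsub, ?_⟩
    have h1 := Set.ncard_le_ncard hsub hTfin
    have h2 : T.ncard ≤ (W : Set H).ncard * (K : Set H).ncard := by
      have := Set.natCard_mul_le (s := (W : Set H)) (t := (K : Set H))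
      rwa [Nat.card_coe_set_eq, Nat.card_coe_set_eq, Nat.card_coe_set_eq] at this
    rw [Set.ncard_coe_finset] at h2
    rw [Finset.card_insert_of_notMem hl]
    have : (I.card + 1 + 2).factorial = (I.card + 3) * (I.card + 2).factorial := by
      rw [show I.card + 1 + 2 = (I.card + 2) + 1 by ring, Nat.factorial_succ]
    rw [this]
    calc _ ≤ T.ncard * 2 := by omega
      _ ≤ W.card * (K : Set H).ncard * 2 := by omega
      _ = W.card * ((K : Set H).ncard * 2) := by ring
      _ ≤ _ := Nat.mul_le_mul hWc hc


/-- The three-cycle `a → b → c → a`. -/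
def c3 {α : Type*} [DecidableEq α] (a b c : α) : Equiv.Perm α := Equiv.swap a b * Equiv.swap b c

theorem c3_conj {α : Type*} [DecidableEq α] (g : Equiv.Perm α) (a b c : α) :
    g * c3 a b c * g⁻¹ = c3 (g a) (g b) (g c) := by
  unfold c3
  rw [Equiv.swap_apply_apply, Equiv.swap_apply_apply]; group

theorem c3_sign {α : Type*} [DecidableEq α] [Fintype α] {a b c : α} (h : a ≠ b) (h' : b ≠ c) :
    Equiv.Perm.sign (c3 a b c) = 1 := by
  simp [c3, Equiv.Perm.sign_swap h, Equiv.Perm.sign_swap h']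

theorem c3_apply {α : Type*} [DecidableEq α] {a b c : α} (h : a ≠ b) (h' : b ≠ c) (h'' : a ≠ c)
    (x : α) : c3 a b c x = if x = a then b else if x = b then c else if x = c then a else x := by
  simp only [c3, Equiv.Perm.mul_apply, Equiv.swap_apply_def]
  split_ifs <;> simp_all

theorem c3_inv {α : Type*} [DecidableEq α] {a b c : α} (h : a ≠ b) (h' : b ≠ c) (h'' : a ≠ c) :
    (c3 a b c)⁻¹ = c3 b a c := by
  rw [inv_eq_iff_mul_eq_one]
  ext x
  rw [Equiv.Perm.mul_apply, c3_apply h.symm h'' h', c3_apply h h' h'', Equiv.Perm.one_apply]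
  split_ifs <;> simp_all

theorem c3_pow {α : Type*} [DecidableEq α] {a b c : α} (h : a ≠ b) (h' : b ≠ c) (h'' : a ≠ c) :
    (c3 a b c) ^ 3 = 1 := by
  rw [pow_succ, pow_two, mul_eq_one_iff_eq_inv, c3_inv h h' h'']
  ext x
  rw [Equiv.Perm.mul_apply, c3_apply h.symm h'' h', c3_apply h h' h'', c3_apply h h' h'']
  split_ifs <;> simp_all

theorem c3_mul_pow {α : Type*} [DecidableEq α] {p q i j : α} (h : p ≠ q) (hi : p ≠ i) (hi' : q ≠ i)
    (hj : p ≠ j) (hj' : q ≠ j) (hij : i ≠ j) :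
    (c3 p q i * c3 p q j) ^ 2 = 1 := by
  have e : c3 p q i * c3 p q j = Equiv.swap p i * Equiv.swap q j := by
    ext x
    rw [Equiv.Perm.mul_apply, c3_apply h hj' hj, c3_apply h hi' hi, Equiv.Perm.mul_apply,
      Equiv.swap_apply_def, Equiv.swap_apply_def]
    split_ifs <;> simp_all
  have hcomm : Equiv.swap p i * Equiv.swap q j = Equiv.swap q j * Equiv.swap p i := by
    rw [Equiv.mul_swap_eq_swap_mul]
    rw [Equiv.swap_apply_of_ne_of_ne h.symm hi', Equiv.swap_apply_of_ne_of_ne hj.symm hij.symm]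
  rw [e, pow_two]
  nth_rewrite 2 [hcomm]
  rw [mul_assoc, ← mul_assoc (Equiv.swap q j)]; simp

theorem carm_gen {α : Type*} [DecidableEq α] [Fintype α] {p q : α} (hpq : p ≠ q)
    (g : Equiv.Perm α) (hg : Equiv.Perm.sign g = 1) :
    g ∈ Subgroup.closure (Set.range fun i : {i : α // i ≠ p ∧ i ≠ q} => c3 p q i.1) := by
  set N := Subgroup.closure (Set.range fun i : {i : α // i ≠ p ∧ i ≠ q} => c3 p q i.1) with hN
  set c := Equiv.swap p q with hc
  have hcc : c * c = 1 := by simp [hc]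
  have hci : c⁻¹ = c := by simp [hc]
  have hx : ∀ i, i ≠ p → i ≠ q → c3 p q i ∈ N := fun i h h' =>
    Subgroup.subset_closure ⟨⟨i, h, h'⟩, rfl⟩
  have hnorm : ∀ x ∈ N, c * x * c ∈ N := by
    intro x hx
    induction hx using Subgroup.closure_induction with
    | mem x hx' =>
      obtain ⟨⟨i, h, h'⟩, rfl⟩ := hx'
      have : c * c3 p q i * c = (c3 p q i)⁻¹ := by
        rw [c3_inv hpq h'.symm h.symm]
        conv_lhs => rw [← hci]
        rw [hci]; nth_rewrite 2 [← hci]; rw [c3_conj]; simp [hc, Equiv.swap_apply_of_ne_of_ne h h']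
      simp only [this]
      exact N.inv_mem (hx i h h')
    | one => simp [hcc]
    | mul x y _ _ hx hy =>
      have : c * (x * y) * c = (c * x * c) * (c * y * c) := by
        calc _ = c * x * 1 * y * c := by group
          _ = _ := by rw [← hcc]; group
      rw [this]; exact N.mul_mem hx hy
    | inv x _ hx =>
      have : c * x⁻¹ * c = (c * x * c)⁻¹ := by simp [hci, mul_assoc]
      rw [this]; exact N.inv_mem hx
  -- `x ∈ N c` formulated as `x * c ∈ N`
  have hNcNc : ∀ x y, x * c ∈ N → y * c ∈ N → x * y ∈ N := by
    intro x y hx hy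
    have : x * y = (x * c) * (c * (y * c) * c) := by
      calc x * y = x * 1 * y * 1 := by group
        _ = x * (c * c) * y * (c * c) := by rw [hcc]
        _ = _ := by group
    rw [this]; exact N.mul_mem hx (hnorm _ hy)
  have hNNc : ∀ x y, x * c ∈ N → y ∈ N → x * y * c ∈ N := by
    intro x y hx hy
    have : x * y * c = (x * c) * (c * y * c) := by
      calc _ = x * 1 * y * c := by group
        _ = x * (c * c) * y * c := by rw [hcc]
        _ = _ := by group
    rw [this]; exact N.mul_mem hx (hnorm _ hy)
  have hpi : ∀ i, i ≠ p → Equiv.swap p i * c ∈ N := by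
    intro i hi
    by_cases hiq : i = q
    · subst hiq; simp [hc]
    · have : Equiv.swap p i * c = c3 p q i := by
        ext x
        rw [c3_apply hpq (Ne.symm hiq) (Ne.symm hi)]
        simp only [hc, Equiv.Perm.mul_apply, Equiv.swap_apply_def]
        clear hN hNcNc hNNc hnorm hx
        split_ifs <;> simp_all
      rw [this]; exact (hx i hi hiq)
  have hsw : ∀ i j, i ≠ j → Equiv.swap i j * c ∈ N := by
    intro i j hij
    by_cases hi : i = p
    · subst hi; exact hpi j hij.symm
    by_cases hj : j = p
    · subst hj; rw [Equiv.swap_comm]; exact hpi i hi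
    have : Equiv.swap i j = Equiv.swap p i * (Equiv.swap p j * Equiv.swap p i) := by
      ext x
      simp only [Equiv.Perm.mul_apply, Equiv.swap_apply_def]
      clear hN hNcNc hNNc hnorm hx hpi
      split_ifs <;> simp_all
    rw [this]
    exact hNNc _ _ (hpi i hi) (hNcNc _ _ (hpi j hj) (hpi i hi))
  have hP : ∀ g : Equiv.Perm α, (g ∈ N ∧ Equiv.Perm.sign g = 1) ∨ (g * c ∈ N ∧ Equiv.Perm.sign g = -1) := by
    intro g
    induction g using Equiv.Perm.swap_induction_on with
    | one => left; simp
    | swap_mul f x y hxy ih =>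
      rcases ih with ⟨h1, h2⟩ | ⟨h1, h2⟩
      · right; exact ⟨hNNc _ _ (hsw x y hxy) h1, by simp [h2, Equiv.Perm.sign_swap hxy]⟩
      · left; exact ⟨hNcNc _ _ (hsw x y hxy) h1, by simp [h2, Equiv.Perm.sign_swap hxy]⟩
  rcases hP g with h | h
  · exact h.1
  · rw [hg] at h; exact absurd h.2 (by decide)

theorem carm_pres {α E : Type*} [DecidableEq α] [Fintype α] [Group E] {p q : α} (hpq : p ≠ q)
    (Y : {i : α // i ≠ p ∧ i ≠ q} → E)
    (h3 : ∀ i, Y i ^ 3 = 1) (h2 : ∀ i j, i ≠ j → (Y i * Y j) ^ 2 = 1) :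
    ∃ σ : alternatingGroup α → E, (∀ g h, σ (g * h) = σ g * σ h) ∧
      ∀ g : alternatingGroup α, ((g : Equiv.Perm α), σ g) ∈
        Subgroup.closure (Set.range fun i : {i : α // i ≠ p ∧ i ≠ q} => (c3 p q i.1, Y i)) := by
  classical
  set X : {i : α // i ≠ p ∧ i ≠ q} → Equiv.Perm α × E := fun i => (c3 p q i.1, Y i) with hX
  set D := Subgroup.closure (Set.range X) with hD
  have hb := carm_bound X
    (fun i => Prod.ext (c3_pow hpq i.2.2.symm i.2.1.symm) (h3 i))
    (fun i j hij => Prod.ext (c3_mul_pow hpq i.2.1.symm i.2.2.symm j.2.1.symm j.2.2.symm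
      (fun h => hij (Subtype.ext h))) (h2 i j hij)) Finset.univ
  rw [Finset.coe_univ, Set.image_univ, ← hD] at hb
  obtain ⟨hfin, hcard⟩ := hb
  have hcI : (Finset.univ : Finset {i : α // i ≠ p ∧ i ≠ q}).card + 2 = Fintype.card α := by
    rw [Finset.card_univ, Fintype.card_subtype]
    have : (Finset.univ.filter fun i : α => i ≠ p ∧ i ≠ q) = (Finset.univ.erase p).erase q := by
      ext; simp; tauto
    rw [this, Finset.card_erase_of_mem (by simp [hpq.symm]), Finset.card_erase_of_mem (by simp),
      Finset.card_univ]
    have : 1 < Fintype.card α := Fintype.one_lt_card_iff.2 ⟨p, q, hpq⟩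
    omega
  rw [hcI] at hcard
  haveI : Nontrivial α := ⟨p, q, hpq⟩
  have hcA := two_mul_nat_card_alternatingGroup (α := α)
  rw [Nat.card_perm, Nat.card_eq_fintype_card (α := α)] at hcA
  have hsurj : ∀ g : Equiv.Perm α, g ∈ alternatingGroup α → ∃ y, (g, y) ∈ D := by
    intro g hg
    have := carm_gen hpq g hg
    have hmap : D.map (MonoidHom.fst _ _) = Subgroup.closure
      (Set.range fun i : {i : α // i ≠ p ∧ i ≠ q} => c3 p q i.1) := by
      rw [hD, MonoidHom.map_closure, ← Set.range_comp]; rfl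
    rw [← hmap] at this
    obtain ⟨⟨g', y⟩, h, rfl⟩ := this
    exact ⟨y, h⟩
  have himg : Prod.fst '' (D : Set (Equiv.Perm α × E)) ⊇ (alternatingGroup α : Set _) := by
    intro g hg
    obtain ⟨y, hy⟩ := hsurj g hg
    exact ⟨_, hy, rfl⟩
  have hinj : Set.InjOn Prod.fst (D : Set (Equiv.Perm α × E)) := by
    apply Set.injOn_of_ncard_image_eq _ hfin
    apply le_antisymm (Set.ncard_image_le hfin)
    have h1 := Set.ncard_le_ncard himg (hfin.image _)
    rw [← Nat.card_coe_set_eq] at h1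
    have : Nat.card (alternatingGroup α) = Nat.card ((alternatingGroup α : Set (Equiv.Perm α))) := rfl
    omega
  choose! σ hσ using hsurj
  refine ⟨fun g => σ g, fun g h => ?_, fun g => hσ g g.2⟩
  have := hinj (hσ _ (g * h).2) (D.mul_mem (hσ g g.2) (hσ h h.2)) rfl
  exact congrArg Prod.snd this


theorem transport4 {α : Type*} [DecidableEq α] [Fintype α] (h8 : 8 ≤ Fintype.card α)
    {a b c d a' b' c' d' : α} (h : [a, b, c, d].Nodup) (h' : [a', b', c', d'].Nodup) :
    ∃ g ∈ alternatingGroup α, g a = a' ∧ g b = b' ∧ g c = c' ∧ g d = d' := by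
  have h1 := alternatingGroup.isMultiplyPretransitive α
  have h2 : MulAction.IsMultiplyPretransitive (alternatingGroup α) α 4 := by
    have hc : Nat.card α = Fintype.card α := Nat.card_eq_fintype_card
    apply MulAction.isMultiplyPretransitive_of_le (n := Nat.card α - 2)
    · omega
    · omega
  rw [MulAction.isMultiplyPretransitive_iff] at h2
  let f : Fin 4 ↪ α := ⟨![a, b, c, d], by
    rw [← List.nodup_ofFn]; simpa [List.ofFn_succ] using h⟩
  let f' : Fin 4 ↪ α := ⟨![a', b', c', d'], by
    rw [← List.nodup_ofFn]; simpa [List.ofFn_succ] using h'⟩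
  obtain ⟨g, hg⟩ := h2 f f'
  have hk : ∀ k, (g : Equiv.Perm α) (f k) = f' k := fun k => by
    have := DFunLike.congr_fun hg k
    exact this
  exact ⟨g, g.2, hk 0, hk 1, hk 2, hk 3⟩

theorem lift_comm {α E : Type*} [DecidableEq α] [Fintype α] [Group E] (h8 : 8 ≤ Fintype.card α)
    (ρ : E →* Equiv.Perm α) (hr : ρ.range = alternatingGroup α) (hk : ρ.ker ≤ Subgroup.center E)
    {a b c : α} (hab : a ≠ b) (hbc : b ≠ c) (hac : a ≠ c) (T : E) (hT : ρ T = c3 a b c)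
    (e : E) (he : ρ e * c3 a b c = c3 a b c * ρ e) : e * T = T * e := by
  have hkc : ∀ k, ρ k = 1 → ∀ x, k * x = x * k := fun k h x =>
    (Subgroup.mem_center_iff.1 (hk (MonoidHom.mem_ker.2 h)) x).symm
  -- commutators commute with `T`
  have hcomm : ∀ x y : E, ρ x * c3 a b c = c3 a b c * ρ x → ρ y * c3 a b c = c3 a b c * ρ y →
      (x⁻¹ * y⁻¹ * x * y) ∈ Subgroup.centralizer {T} := by
    have h1 : ∀ x : E, ρ x * c3 a b c = c3 a b c * ρ x → ∃ k, ρ k = 1 ∧ x * T * x⁻¹ = k * T := by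
      intro x hx
      refine ⟨x * T * x⁻¹ * T⁻¹, ?_, by group⟩
      rw [map_mul, map_inv, map_mul, map_mul, hT, hx, map_inv]; simp
    intro x y hx hy
    obtain ⟨k, hk, hxk⟩ := h1 x hx
    obtain ⟨l, hl, hyl⟩ := h1 y hy
    have e1 : (x * y) * T * (x * y)⁻¹ = k * l * T := by
      calc _ = x * (y * T * y⁻¹) * x⁻¹ := by group
        _ = l * (x * T * x⁻¹) := by rw [hyl, ← mul_assoc x, ← hkc l hl]; group
        _ = _ := by rw [hxk, ← mul_assoc, hkc l hl]
    have e2 : (y * x) * T * (y * x)⁻¹ = k * l * T := by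
      calc _ = y * (x * T * x⁻¹) * y⁻¹ := by group
        _ = k * (y * T * y⁻¹) := by rw [hxk, ← mul_assoc y, ← hkc k hk]; group
        _ = _ := by rw [hyl, ← mul_assoc]
    rw [Subgroup.mem_centralizer_singleton_iff]
    have e3 := e1.trans e2.symm
    calc x⁻¹ * y⁻¹ * x * y * T = (y * x)⁻¹ * ((x * y) * T * (x * y)⁻¹) * (x * y) := by group
      _ = T * (x⁻¹ * y⁻¹ * x * y) := by rw [e3]; group
  have hfix : ∀ g : Equiv.Perm α, g a = a → g b = b → g c = c → g * c3 a b c = c3 a b c * g := by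
    intro g ha hb hc
    have := c3_conj g a b c
    rw [ha, hb, hc] at this
    rw [← mul_inv_eq_iff_eq_mul]; exact this
  let s : Finset α := ((Finset.univ.erase a).erase b).erase c
  have hs : 5 ≤ Nat.card s := by
    rw [Nat.card_eq_fintype_card, Fintype.card_coe, Finset.card_erase_of_mem, Finset.card_erase_of_mem,
      Finset.card_erase_of_mem, Finset.card_univ]
    · omega
    · simp
    · simp [hab.symm]
    · simp [hac.symm, hbc.symm]
  have hsa : ∀ u : alternatingGroup s, ∀ x, x ∉ s → (alternatingGroup.ofSubtype s u).1 x = x := by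
    intro u x hx
    rw [alternatingGroup.coe_ofSubtype]
    exact Equiv.Perm.ofSubtype_apply_of_not_mem _ hx
  have hlift : ∀ g ∈ alternatingGroup α, ∃ x, ρ x = g := fun g hg => by rw [← hr] at hg; exact hg
  -- even permutations fixing a b c
  have hfixed : ∀ x : E, ρ x a = a → ρ x b = b → ρ x c = c → x * T = T * x := by
    intro x ha hb hc
    have hxA : ρ x ∈ alternatingGroup α := by rw [← hr]; exact ⟨x, rfl⟩
    have hmem : (⟨ρ x, hxA⟩ : alternatingGroup α) ∈ (alternatingGroup.ofSubtype s).range := by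
      rw [alternatingGroup.mem_range_ofSubtype_iff]
      intro y hy
      rw [Equiv.Perm.mem_support] at hy
      simp only [s, Finset.mem_erase, Finset.mem_univ, and_true]
      refine ⟨?_, ?_, ?_⟩ <;> rintro rfl <;> contradiction
    obtain ⟨u, hu⟩ := hmem
    have hle : commutator (alternatingGroup s) ≤ ((Subgroup.centralizer {T}).map ρ).comap
        ((alternatingGroup α).subtype.comp (alternatingGroup.ofSubtype s)) := by
      rw [commutator_def, Subgroup.commutator_le]
      intro v _ w _
      obtain ⟨v', hv'⟩ := hlift _ (alternatingGroup.ofSubtype s v⁻¹).2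
      obtain ⟨w', hw'⟩ := hlift _ (alternatingGroup.ofSubtype s w⁻¹).2
      refine ⟨_, hcomm v' w' ?_ ?_, ?_⟩
      · rw [hv']; apply hfix <;> apply hsa <;> simp [s]
      · rw [hw']; apply hfix <;> apply hsa <;> simp [s]
      · simp only [map_mul, map_inv, hv', hw', commutatorElement_def]
        simp
    rw [commutator_alternatingGroup_eq_top hs] at hle
    obtain ⟨m, hm, hmu⟩ := hle (Subgroup.mem_top u)
    have hmx : ρ m = ρ x := by
      rw [hmu]; simp [hu]
    have hmT : m * T = T * m := Subgroup.mem_centralizer_singleton_iff.1 hm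
    have hkx := hkc (x * m⁻¹) (by simp [hmx])
    calc x * T = (x * m⁻¹) * (m * T) := by group
      _ = T * ((x * m⁻¹) * m) := by rw [hmT, ← mul_assoc, hkx]; group
      _ = T * x := by group
  -- reduction to the fixed case
  have hta : c3 a b c a = b := by simp [c3_apply hab hbc hac]
  have htb : c3 a b c b = c := by simp [c3_apply hab hbc hac, hab.symm]
  have htc : c3 a b c c = a := by simp [c3_apply hab hbc hac, hac.symm, hbc.symm]
  have hfixa : ∀ x : E, ρ x * c3 a b c = c3 a b c * ρ x → ρ x a = a → x * T = T * x := by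
    intro x hx ha
    have hb : ρ x b = b := by
      have := DFunLike.congr_fun hx a
      simpa [hta, ha] using this
    have hc : ρ x c = c := by
      have := DFunLike.congr_fun hx b
      simpa [htb, hb] using this
    exact hfixed x ha hb hc
  have hcase : ρ e a = a ∨ ρ e a = b ∨ ρ e a = c := by
    by_contra hcon
    push Not at hcon
    have := DFunLike.congr_fun he a
    rw [Equiv.Perm.mul_apply, Equiv.Perm.mul_apply, hta, c3_apply hab hbc hac (ρ e a)] at this
    simp [hcon, hab.symm] at this
  have hTi : (c3 a b c)⁻¹ * ρ e * c3 a b c = c3 a b c * ((c3 a b c)⁻¹ * ρ e) := by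
    rw [mul_assoc, he]; group
  rcases hcase with h | h | h
  · exact hfixa e he h
  · have := hfixa (T⁻¹ * e) (by rw [map_mul, map_inv, hT]; exact hTi)
      (by rw [map_mul, map_inv, hT, Equiv.Perm.mul_apply, h, Equiv.Perm.inv_eq_iff_eq, hta])
    calc e * T = T * ((T⁻¹ * e) * T) := by group
      _ = T * e := by rw [this]; group
  · have := hfixa (T * e) (by rw [map_mul, hT, mul_assoc, he])
      (by rw [map_mul, hT, Equiv.Perm.mul_apply, h, htc])
    calc e * T = T⁻¹ * ((T * e) * T) := by group
      _ = T * e := by rw [this]; group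

theorem lift_main {α E : Type*} [DecidableEq α] [Fintype α] [Group E] (h8 : 8 ≤ Fintype.card α)
    (ρ : E →* Equiv.Perm α) (hr : ρ.range = alternatingGroup α) (hk : ρ.ker ≤ Subgroup.center E)
    {p q : α} (hpq : p ≠ q) :
    ∃ z : E, ρ z = 1 ∧ z ^ 2 = 1 ∧ ∃ X : {i : α // i ≠ p ∧ i ≠ q} → E,
      (∀ i, ρ (X i) = c3 p q i.1) ∧ (∀ i, X i ^ 3 = 1) ∧
      ∀ i j, i ≠ j → (X i * X j) ^ 2 = z := by
  have hkc : ∀ k, ρ k = 1 → ∀ x, k * x = x * k := fun k h x =>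
    (Subgroup.mem_center_iff.1 (hk (MonoidHom.mem_ker.2 h)) x).symm
  have hlift : ∀ g ∈ alternatingGroup α, ∃ x, ρ x = g := fun g hg => by rw [← hr] at hg; exact hg
  obtain ⟨r, hr1⟩ : ∃ r, r ∉ ({p, q} : Finset α) := by
    by_contra hcon; push Not at hcon
    have h1 := Finset.card_le_card (fun x (_ : x ∈ (Finset.univ : Finset α)) => hcon x)
    have h2 := Finset.card_le_two (a := p) (b := q)
    rw [Finset.card_univ] at h1; omega
  obtain ⟨u, hu1⟩ : ∃ u, u ∉ ({p, q, r} : Finset α) := by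
    by_contra hcon; push Not at hcon
    have h1 := Finset.card_le_card (fun x (_ : x ∈ (Finset.univ : Finset α)) => hcon x)
    have h2 := Finset.card_le_three (a := p) (b := q) (c := r)
    rw [Finset.card_univ] at h1; omega
  simp only [Finset.mem_insert, Finset.mem_singleton, not_or] at hr1 hu1
  obtain ⟨hrp, hrq⟩ := hr1
  obtain ⟨hup, huq, hur⟩ := hu1
  have tr4 : ∀ {a b c d a' b' c' d' : α}, [a, b, c, d].Nodup → [a', b', c', d'].Nodup →
      ∃ e : E, ρ e a = a' ∧ ρ e b = b' ∧ ρ e c = c' ∧ ρ e d = d' := by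
    intro a b c d a' b' c' d' h h'
    obtain ⟨g, hg, h1⟩ := transport4 h8 h h'
    obtain ⟨e, rfl⟩ := hlift g hg
    exact ⟨e, h1⟩
  obtain ⟨T0, hT0⟩ := hlift (c3 p q r) (c3_sign hpq (Ne.symm hrq))
  obtain ⟨e, he1, he2, he3, -⟩ : ∃ e : E, ρ e p = q ∧ ρ e q = p ∧ ρ e r = r ∧ ρ e u = u :=
    tr4 (by simp; grind) (by simp; grind)
  have heT : ρ (e * T0 * e⁻¹) = (c3 p q r)⁻¹ := by
    rw [map_mul, map_mul, map_inv, hT0, c3_conj, he1, he2, he3,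
      c3_inv hpq (Ne.symm hrq) (Ne.symm hrp)]
  -- the canonical lift
  obtain ⟨T, hT, hT3, hTe⟩ : ∃ T, ρ T = c3 p q r ∧ T ^ 3 = 1 ∧ e * T * e⁻¹ = T⁻¹ := by
    obtain ⟨b, hb⟩ : ∃ b, b = T0 ^ 3 := ⟨_, rfl⟩
    obtain ⟨c, hc⟩ : ∃ c, c = T0 * (e * T0 * e⁻¹) := ⟨_, rfl⟩
    have hb1 : ρ b = 1 := by rw [hb, map_pow, hT0, c3_pow hpq (Ne.symm hrq) (Ne.symm hrp)]
    have hc1 : ρ c = 1 := by rw [hc, map_mul, heT, hT0]; simp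
    have hcT : e * T0 * e⁻¹ = T0⁻¹ * c := by rw [hc]; group
    have hcb : c ^ 3 = b ^ 2 := by
      have h1 : (e * T0 * e⁻¹) ^ 3 = b := by
        rw [conj_pow, ← hb, ← hkc b hb1]; group
      have h2 : (T0⁻¹ * c) ^ 3 = b⁻¹ * c ^ 3 := by
        rw [(show Commute T0⁻¹ c from (hkc c hc1 _).symm).mul_pow, inv_pow, ← hb]
      rw [hcT, h2] at h1
      rw [pow_two]; exact inv_mul_eq_iff_eq_mul.1 h1
    obtain ⟨w, hw⟩ : ∃ w, w = b⁻¹ * c := ⟨_, rfl⟩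
    have hw1 : ρ w = 1 := by rw [hw, map_mul, map_inv, hb1, hc1]; simp
    have hbc : Commute b⁻¹ c := (hkc c hc1 _).symm
    have hw3 : b * w ^ 3 = 1 := by
      rw [hw, hbc.mul_pow, hcb]; group
    have hw2 : c * w = w⁻¹ := by
      rw [eq_inv_iff_mul_eq_one]
      have : w * w = b⁻¹ ^ 2 * c ^ 2 := by rw [← pow_two, hw, hbc.mul_pow]
      rw [mul_assoc, this, hkc c hc1, mul_assoc, ← pow_succ, hcb]; group
    refine ⟨T0 * w, by rw [map_mul, hT0, hw1, mul_one], ?_, ?_⟩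
    · rw [(show Commute T0 w from (hkc w hw1 _).symm).mul_pow, ← hb, hw3]
    · calc e * (T0 * w) * e⁻¹ = e * T0 * (w * e⁻¹) := by group
        _ = (e * T0 * e⁻¹) * w := by rw [hkc w hw1]; group
        _ = T0⁻¹ * w⁻¹ := by rw [hcT, mul_assoc, hw2]
        _ = (T0 * w)⁻¹ := by rw [mul_inv_rev, hkc w⁻¹ (by simp [hw1])]
  have huniq : ∀ x y : E, ρ (x * T * x⁻¹) = ρ (y * T * y⁻¹) → x * T * x⁻¹ = y * T * y⁻¹ := by
    intro x y h
    have h1 : ρ (y⁻¹ * x) * c3 p q r = c3 p q r * ρ (y⁻¹ * x) := by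
      rw [← hT]
      simp only [map_mul, map_inv] at h ⊢
      calc (ρ y)⁻¹ * ρ x * ρ T = (ρ y)⁻¹ * (ρ x * ρ T * (ρ x)⁻¹) * ρ x := by group
        _ = _ := by rw [h]; group
    have h2 := lift_comm h8 ρ hr hk hpq (Ne.symm hrq) (Ne.symm hrp) T hT _ h1
    calc x * T * x⁻¹ = y * ((y⁻¹ * x) * T) * x⁻¹ := by group
      _ = _ := by rw [h2]; group
  have hx : ∀ i : {i : α // i ≠ p ∧ i ≠ q}, ∃ x : E, ρ x p = p ∧ ρ x q = q ∧ ρ x r = i.1 := by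
    rintro ⟨i, hi1, hi2⟩
    obtain ⟨v, hv⟩ : ∃ v, v ∉ ({p, q, i} : Finset α) := by
      by_contra hcon; push Not at hcon
      have h1 := Finset.card_le_card (fun x (_ : x ∈ (Finset.univ : Finset α)) => hcon x)
      have h2 := Finset.card_le_three (a := p) (b := q) (c := i)
      rw [Finset.card_univ] at h1; omega
    simp only [Finset.mem_insert, Finset.mem_singleton, not_or] at hv
    obtain ⟨x, h1, h2, h3, -⟩ : ∃ e : E, ρ e p = p ∧ ρ e q = q ∧ ρ e r = i ∧ ρ e u = v :=
      tr4 (by simp; grind) (by simp; grind)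
    exact ⟨x, h1, h2, h3⟩
  choose x hxp hxq hxr using hx
  have hX : ∀ i, ρ (x i * T * (x i)⁻¹) = c3 p q i.1 := by
    intro i
    rw [map_mul, map_mul, map_inv, hT, c3_conj, hxp, hxq, hxr]
  obtain ⟨X, hXd⟩ : ∃ X : {i : α // i ≠ p ∧ i ≠ q} → E, ∀ i, X i = x i * T * (x i)⁻¹ := ⟨_, fun _ => rfl⟩
  have hXr : ∀ i, ρ (X i) = c3 p q i.1 := fun i => by rw [hXd, hX]
  have hz1 : ∀ i j, i ≠ j → ρ ((X i * X j) ^ 2) = 1 := by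
    intro i j hij
    rw [map_pow, map_mul, hXr, hXr]
    exact c3_mul_pow hpq i.2.1.symm i.2.2.symm j.2.1.symm j.2.2.symm (fun h => hij (Subtype.ext h))
  have hmove : ∀ (e' : E) i k, ρ e' p = p → ρ e' q = q → ρ e' i.1 = k.1 → e' * X i * e'⁻¹ = X k := by
    intro e' i k h1 h2 h3
    have := huniq (e' * x i) (x k) (by
      rw [hX]
      calc ρ (e' * x i * T * (e' * x i)⁻¹) = ρ (e' * (x i * T * (x i)⁻¹) * e'⁻¹) := by congr 1; group
        _ = _ := by rw [map_mul, map_mul, map_inv, hX, c3_conj, h1, h2, h3])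
    rw [hXd, hXd, ← this]; group
  have hmove2 : ∀ (e' : E) i k, ρ e' p = q → ρ e' q = p → ρ e' i.1 = k.1 →
      e' * X i * e'⁻¹ = (X k)⁻¹ := by
    intro e' i k h1 h2 h3
    have hk' : (X k)⁻¹ = x k * e * T * (x k * e)⁻¹ := by
      calc (X k)⁻¹ = x k * T⁻¹ * (x k)⁻¹ := by rw [hXd]; group
        _ = _ := by rw [← hTe]; group
    have := huniq (e' * x i) (x k * e) (by
      rw [← hk', map_inv, hXr, c3_inv hpq k.2.2.symm k.2.1.symm]
      calc ρ (e' * x i * T * (e' * x i)⁻¹) = ρ (e' * (x i * T * (x i)⁻¹) * e'⁻¹) := by congr 1; group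
        _ = _ := by rw [map_mul, map_mul, map_inv, hX, c3_conj, h1, h2, h3])
    rw [hk', hXd, ← this]; group
  have hconj : ∀ (e' A B : E), ρ ((A * B) ^ 2) = 1 →
      (A * B) ^ 2 = ((e' * A * e'⁻¹) * (e' * B * e'⁻¹)) ^ 2 := by
    intro e' A B h
    have h1 := hkc _ h e'⁻¹
    calc (A * B) ^ 2 = e' * (e'⁻¹ * (A * B) ^ 2) := by group
      _ = _ := by rw [← h1, pow_two, pow_two]; group
  let r' : {i : α // i ≠ p ∧ i ≠ q} := ⟨r, hrp, hrq⟩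
  let u' : {i : α // i ≠ p ∧ i ≠ q} := ⟨u, hup, huq⟩
  have hru : r' ≠ u' := fun h => hur (Subtype.ext_iff.1 h).symm
  refine ⟨(X r' * X u') ^ 2, hz1 _ _ hru, ?_, X, hXr, ?_, ?_⟩
  · obtain ⟨e', h1, h2, h3, h4⟩ : ∃ e : E, ρ e p = q ∧ ρ e q = p ∧ ρ e r = u ∧ ρ e u = r :=
      tr4 (by simp; grind) (by simp; grind)
    have h5 := hconj e' (X r') (X u') (hz1 _ _ hru)
    rw [hmove2 e' r' u' h1 h2 h3, hmove2 e' u' r' h1 h2 h4, ← mul_inv_rev, inv_pow] at h5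
    rw [pow_two ((X r' * X u') ^ 2)]
    exact mul_eq_one_iff_eq_inv.2 h5
  · intro i
    rw [hXd, conj_pow, hT3]; group
  · rintro ⟨i, hi1, hi2⟩ ⟨j, hj1, hj2⟩ hij
    have hij' : i ≠ j := fun h => hij (Subtype.ext h)
    obtain ⟨e', h1, h2, h3, h4⟩ : ∃ e : E, ρ e p = p ∧ ρ e q = q ∧ ρ e i = r ∧ ρ e j = u :=
      tr4 (by simp; grind) (by simp; grind)
    rw [hconj e' _ _ (hz1 _ _ hij), hmove e' _ r' h1 h2 h3, hmove e' _ u' h1 h2 h4]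

/-- The central extension attached to a 2-cocycle with trivial coefficients. -/
structure CExt {G M : Type} [Group G] [AddCommGroup M] (f : G → G → M)
    (hf : ∀ g h j, f (g * h) j + f g h = f h j + f g (h * j)) where
  a : M
  g : G

theorem CExt.ext' {G M : Type} [Group G] [AddCommGroup M] {f : G → G → M}
    {hf : ∀ g h j, f (g * h) j + f g h = f h j + f g (h * j)} {x y : CExt f hf}
    (h1 : x.a = y.a) (h2 : x.g = y.g) : x = y := by
  cases x; cases y; simp_all

instance CExt.group {G M : Type} [Group G] [AddCommGroup M] (f : G → G → M)
    (hf : ∀ g h j, f (g * h) j + f g h = f h j + f g (h * j)) : Group (CExt f hf) :=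
  letI : Mul (CExt f hf) := ⟨fun x y => ⟨x.a + y.a + f x.g y.g, x.g * y.g⟩⟩
  letI : One (CExt f hf) := ⟨⟨-f 1 1, 1⟩⟩
  letI : Inv (CExt f hf) := ⟨fun x => ⟨-x.a - f x.g⁻¹ x.g - f 1 1, x.g⁻¹⟩⟩
  Group.ofLeftAxioms
    (fun x y z => by
      apply CExt.ext'
      · change x.a + y.a + f x.g y.g + z.a + f (x.g * y.g) z.g =
          x.a + (y.a + z.a + f y.g z.g) + f x.g (y.g * z.g)
        calc _ = x.a + y.a + z.a + (f (x.g * y.g) z.g + f x.g y.g) := by abel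
          _ = _ := by rw [hf]; abel
      · exact mul_assoc _ _ _)
    (fun x => by
      have h := hf 1 1 x.g
      rw [one_mul, one_mul] at h
      have h := add_left_cancel h
      apply CExt.ext'
      · change -f 1 1 + x.a + f 1 x.g = x.a
        rw [← h]; abel
      · exact one_mul _)
    (fun x => by
      apply CExt.ext'
      · change -x.a - f x.g⁻¹ x.g - f 1 1 + x.a + f x.g⁻¹ x.g = - f 1 1
        abel
      · exact inv_mul_cancel _)

theorem CExt.mul_a {G M : Type} [Group G] [AddCommGroup M] {f : G → G → M}
    {hf : ∀ g h j, f (g * h) j + f g h = f h j + f g (h * j)} (x y : CExt f hf) :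
    (x * y).a = x.a + y.a + f x.g y.g := rfl

theorem CExt.mul_g {G M : Type} [Group G] [AddCommGroup M] {f : G → G → M}
    {hf : ∀ g h j, f (g * h) j + f g h = f h j + f g (h * j)} (x y : CExt f hf) :
    (x * y).g = x.g * y.g := rfl

theorem CExt.one_a {G M : Type} [Group G] [AddCommGroup M] {f : G → G → M}
    {hf : ∀ g h j, f (g * h) j + f g h = f h j + f g (h * j)} :
    (1 : CExt f hf).a = - f 1 1 := rfl

theorem CExt.one_g {G M : Type} [Group G] [AddCommGroup M] {f : G → G → M}
    {hf : ∀ g h j, f (g * h) j + f g h = f h j + f g (h * j)} :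
    (1 : CExt f hf).g = 1 := rfl

/-- Projection to the quotient group. -/
def CExt.pr {G M : Type} [Group G] [AddCommGroup M] (f : G → G → M)
    (hf : ∀ g h j, f (g * h) j + f g h = f h j + f g (h * j)) : CExt f hf →* G where
  toFun := fun x => x.g
  map_one' := rfl
  map_mul' := fun _ _ => rfl

/-- Push-out along a map of coefficients. -/
def CExt.push {G M M' : Type} [Group G] [AddCommGroup M] [AddCommGroup M'] (f : G → G → M)
    (hf : ∀ g h j, f (g * h) j + f g h = f h j + f g (h * j)) (φ : M →+ M')
    (hf' : ∀ g h j, φ (f (g * h) j) + φ (f g h) = φ (f h j) + φ (f g (h * j))) :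
    CExt f hf →* CExt (fun g h => φ (f g h)) hf' where
  toFun := fun x => ⟨φ x.a, x.g⟩
  map_one' := CExt.ext' (by simp [CExt.one_a]) rfl
  map_mul' := fun x y => CExt.ext' (by simp [CExt.mul_a]) rfl

theorem cocycle_main {α M : Type} [DecidableEq α] [Fintype α] [AddCommGroup M]
    (h8 : 8 ≤ Fintype.card α) (f : alternatingGroup α → alternatingGroup α → M)
    (hf : ∀ g h j, f (g * h) j + f g h = f h j + f g (h * j)) :
    ∃ z : M, z + z = 0 ∧ ∀ (M' : Type) [AddCommGroup M'] (φ : M →+ M'), φ z = 0 →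
      ∃ c : alternatingGroup α → M', ∀ g h, φ (f g h) = c h - c (g * h) + c g := by
  have : Nontrivial α := Fintype.one_lt_card_iff_nontrivial.1 (by omega)
  obtain ⟨p, q, hpq⟩ := exists_pair_ne α
  let ρ : CExt f hf →* Equiv.Perm α := (alternatingGroup α).subtype.comp (CExt.pr f hf)
  have h1 : ∀ g, f 1 g = f 1 1 := fun g => by
    have h := hf 1 1 g
    rw [one_mul, one_mul] at h
    exact (add_left_cancel h).symm
  have h2 : ∀ g, f g 1 = f 1 1 := fun g => by
    have h := hf g 1 1
    rw [mul_one, mul_one] at h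
    exact add_right_cancel h
  have hker : ∀ x, ρ x = 1 → x.g = 1 := fun x hx => Subtype.ext hx
  obtain ⟨z, hz1, hz2, X, hX, hX3, hX2⟩ := lift_main h8 ρ (by
      ext g
      constructor
      · rintro ⟨x, rfl⟩
        exact x.g.2
      · intro hg
        exact ⟨⟨0, ⟨g, hg⟩⟩, rfl⟩) (by
      intro x hx
      have hx := hker x hx
      rw [Subgroup.mem_center_iff]
      intro y
      apply CExt.ext'
      · rw [CExt.mul_a, CExt.mul_a, hx, h1, h2]; abel
      · rw [CExt.mul_g, CExt.mul_g, hx, one_mul, mul_one]) hpq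
  have hzg := hker z hz1
  refine ⟨z.a + f 1 1, ?_, ?_⟩
  · have := congrArg CExt.a hz2
    rw [pow_two, CExt.mul_a, hzg, CExt.one_a] at this
    calc z.a + f 1 1 + (z.a + f 1 1) = (z.a + z.a + f 1 1) + f 1 1 := by abel
      _ = 0 := by rw [this]; abel
  · intro M' _ φ hφ
    have hf' : ∀ g h j, φ (f (g * h) j) + φ (f g h) = φ (f h j) + φ (f g (h * j)) := by
      intro g h j; rw [← map_add, hf, map_add]
    let Φ := CExt.push f hf φ hf'
    have hΦz : Φ z = 1 := by
      apply CExt.ext'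
      · change φ z.a = - φ (f 1 1)
        rw [map_add] at hφ
        exact eq_neg_of_add_eq_zero_left hφ
      · exact hzg
    obtain ⟨σ, hσ, hσc⟩ := carm_pres hpq (fun i => Φ (X i))
      (fun i => by rw [← map_pow, hX3, map_one])
      (fun i j hij => by rw [← map_mul, ← map_pow, hX2 i j hij, hΦz])
    have hσg : ∀ g, (σ g).g = g := by
      intro g
      let S : Subgroup (Equiv.Perm α × CExt (fun g h => φ (f g h)) hf') :=
        { carrier := {x | x.1 = (x.2.g : Equiv.Perm α)}
          one_mem' := rfl
          mul_mem' := by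
            intro x y hx hy
            change x.1 * y.1 = ((x.2.g * y.2.g : alternatingGroup α) : Equiv.Perm α)
            rw [Subgroup.coe_mul, ← hx, ← hy]
          inv_mem' := by
            intro x hx
            change x.1⁻¹ = ((x.2.g⁻¹ : alternatingGroup α) : Equiv.Perm α)
            rw [Subgroup.coe_inv, ← hx] }
      have hS : Subgroup.closure (Set.range fun i => (c3 p q i.1, Φ (X i))) ≤ S := by
        rw [Subgroup.closure_le]
        rintro _ ⟨i, rfl⟩
        exact (hX i).symm
      exact Subtype.ext (hS (hσc g)).symm
    refine ⟨fun g => - (σ g).a, fun g h => ?_⟩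
    have := congrArg CExt.a (hσ g h)
    rw [CExt.mul_a, hσg, hσg] at this
    dsimp only; rw [this]; abel

theorem circ_two (x y : AddCircle (1 : ℚ)) (hx : x + x = 0) (hy : y + y = 0) :
    x = 0 ∨ y = 0 ∨ x - y = 0 := by
  induction x using QuotientAddGroup.induction_on with | H a => ?_
  induction y using QuotientAddGroup.induction_on with | H b => ?_
  have hx' : ((a + a : ℚ) : AddCircle (1 : ℚ)) = 0 := hx
  have hy' : ((b + b : ℚ) : AddCircle (1 : ℚ)) = 0 := hy
  change (a : AddCircle (1 : ℚ)) = 0 ∨ (b : AddCircle (1 : ℚ)) = 0 ∨ ((a - b : ℚ) : AddCircle (1 : ℚ)) = 0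
  simp only [AddCircle.coe_eq_zero_iff, zsmul_one] at *
  obtain ⟨m, hm⟩ := hx'
  obtain ⟨n, hn⟩ := hy'
  rcases Int.even_or_odd' m with ⟨k, rfl | rfl⟩
  · left; exact ⟨k, by push_cast at hm; linarith⟩
  · rcases Int.even_or_odd' n with ⟨l, rfl | rfl⟩
    · right; left; exact ⟨l, by push_cast at hn; linarith⟩
    · right; right; exact ⟨k - l, by push_cast at hm hn ⊢; linarith⟩

theorem cocycle_two {α : Type} [DecidableEq α] [Fintype α]
    (h8 : 8 ≤ Fintype.card α) (f f' : alternatingGroup α → alternatingGroup α → AddCircle (1 : ℚ))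
    (hf : ∀ g h j, f (g * h) j + f g h = f h j + f g (h * j))
    (hf' : ∀ g h j, f' (g * h) j + f' g h = f' h j + f' g (h * j)) :
    (∃ c : alternatingGroup α → AddCircle (1 : ℚ), ∀ g h, f g h = c h - c (g * h) + c g) ∨
    (∃ c : alternatingGroup α → AddCircle (1 : ℚ), ∀ g h, f' g h = c h - c (g * h) + c g) ∨
    (∃ c : alternatingGroup α → AddCircle (1 : ℚ), ∀ g h, f g h - f' g h = c h - c (g * h) + c g) := by
  obtain ⟨z, hz, H⟩ := cocycle_main h8 (fun g h => (f g h, f' g h))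
    (fun g h j => Prod.ext (hf g h j) (hf' g h j))
  have h1 := congrArg Prod.fst hz
  have h2 := congrArg Prod.snd hz
  rcases circ_two z.1 z.2 h1 h2 with h | h | h
  · exact Or.inl (H _ (AddMonoidHom.fst _ _) h)
  · exact Or.inr (Or.inl (H _ (AddMonoidHom.snd _ _) h))
  · exact Or.inr (Or.inr (H _ (AddMonoidHom.fst _ _ - AddMonoidHom.snd _ _) h))

theorem ext_nontriv {Γ G : Type} [Group Γ] [Group G] (π : Γ →* G) (hs : Function.Surjective π)
    (hk : π.ker ≤ Subgroup.center Γ) (x y w : Γ) (hxy : x * y = w * (y * x)) (hw : π w = 1)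
    (hw1 : w ≠ 1) :
    ∃ f : G → G → AddCircle (1 : ℚ),
      (∀ g h j, f (g * h) j + f g h = f h j + f g (h * j)) ∧
      ¬ ∃ c : G → AddCircle (1 : ℚ), ∀ g h, f g h = c h - c (g * h) + c g := by
  have hkc : ∀ k, π k = 1 → ∀ x, k * x = x * k := fun k h x =>
    (Subgroup.mem_center_iff.1 (hk (MonoidHom.mem_ker.2 h)) x).symm
  let _ : CommGroup π.ker :=
    { (inferInstance : Group π.ker) with
      mul_comm := fun a b => Subtype.ext (hkc a.1 a.2 b.1) }
  obtain ⟨s, hs⟩ := hs.hasRightInverse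
  have hs : ∀ g, π (s g) = g := hs
  obtain ⟨k, hkd⟩ : ∃ k : G → G → π.ker, ∀ g h, (k g h : Γ) = s g * s h * (s (g * h))⁻¹ :=
    ⟨fun g h => ⟨s g * s h * (s (g * h))⁻¹, by simp [MonoidHom.mem_ker, hs]⟩, fun _ _ => rfl⟩
  have hkk : ∀ g h, (k g h : Γ) * s (g * h) = s g * s h := fun g h => by rw [hkd]; group
  have hw0 : Additive.ofMul (⟨w, hw⟩ : π.ker) ≠ 0 := fun h => hw1 (congrArg Subtype.val h)
  obtain ⟨χ, hχ⟩ := CharacterModule.exists_character_apply_ne_zero_of_ne_zero hw0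
  obtain ⟨X, hXm, hXw⟩ : ∃ X : π.ker → AddCircle (1 : ℚ), (∀ a b, X (a * b) = X a + X b) ∧
      X ⟨w, hw⟩ ≠ 0 := ⟨fun a => χ (Additive.ofMul a), fun a b => map_add χ _ _, hχ⟩
  refine ⟨fun g h => X (k g h), ?_, ?_⟩
  · intro g h j
    rw [← hXm, ← hXm]
    congr 1
    rw [mul_comm (k (g * h) j)]
    apply Subtype.ext
    apply mul_right_cancel (b := s (g * h * j))
    rw [Subgroup.coe_mul, Subgroup.coe_mul, mul_assoc, hkk, ← mul_assoc, hkk, mul_assoc _ _ (s _)]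
    rw [mul_assoc g h j, mul_assoc (k h j : Γ), hkk, ← mul_assoc (k h j : Γ),
      hkc (k h j) (k h j).2, mul_assoc (s g), hkk]
  · rintro ⟨c, hc⟩
    have hcm : π x * π y = π y * π x := by
      rw [← map_mul, hxy, map_mul, hw, one_mul, map_mul]
    have h1 := hc (π x) (π y)
    have h2 := hc (π y) (π x)
    rw [← hcm] at h2
    have h3 : k (π x) (π y) = ⟨w, hw⟩ * k (π y) (π x) := by
      apply Subtype.ext
      apply mul_right_cancel (b := s (π x * π y))
      rw [Subgroup.coe_mul, hkk, mul_assoc, hcm, hkk]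
      have e1 := hkc (s (π x) * x⁻¹) (by simp [hs])
      have e2 := hkc (s (π y) * y⁻¹) (by simp [hs])
      obtain ⟨a, ha⟩ : ∃ a, a = s (π x) * x⁻¹ := ⟨_, rfl⟩
      obtain ⟨b, hb⟩ : ∃ b, b = s (π y) * y⁻¹ := ⟨_, rfl⟩
      have ha' : s (π x) = a * x := by rw [ha]; group
      have hb' : s (π y) = b * y := by rw [hb]; group
      rw [← ha] at e1
      rw [← hb] at e2
      rw [ha', hb']
      calc a * x * (b * y) = a * (b * x) * y := by rw [e2 x]; group
        _ = a * b * (x * y) := by group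
        _ = a * b * w * (y * x) := by rw [hxy]; group
        _ = w * (b * (a * y) * x) := by
          have : (a * b) * w = w * (a * b) := by rw [mul_assoc, e2 w, ← mul_assoc, e1 w, mul_assoc]
          rw [this, e1 b]; group
        _ = w * (b * y * (a * x)) := by rw [e1 y]; group
    dsimp only at h1 h2
    rw [h3, hXm] at h1
    apply hXw
    have h4 : X ⟨w, hw⟩ + X (k (π y) (π x)) = X (k (π y) (π x)) := by
      rw [h1, h2]; abel
    simpa using h4

theorem cliff_exists (n : ℕ) : ∃ (B : Type) (_ : Ring B) (e : Fin n → B), (1 : B) ≠ -1 ∧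
    IsUnit (2 : B) ∧ (∀ i, e i * e i = 1) ∧ (∀ i j, i ≠ j → e i * e j = - (e j * e i)) ∧
    ∀ u : B, (∀ i, u * e i = e i * u) → ∀ v, u * v = v * u := by
  let Q : QuadraticForm ℚ (Fin n → ℚ) := QuadraticMap.weightedSumSquares ℚ (fun _ => (1 : ℚ))
  have hQ : ∀ v, Q v = ∑ i, v i * v i := fun v => by
    simp [Q, QuadraticMap.weightedSumSquares_apply]
  have : Invertible (2 : ℚ) := invertibleOfNonzero two_ne_zero
  have h2 : IsUnit (2 : CliffordAlgebra Q) := by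
    have := (IsUnit.mk0 (2 : ℚ) two_ne_zero).map (algebraMap ℚ (CliffordAlgebra Q))
    rwa [map_ofNat] at this
  refine ⟨CliffordAlgebra Q, inferInstance, fun i => CliffordAlgebra.ι Q (Pi.single i 1), ?_, h2,
    ?_, ?_, ?_⟩
  · intro h
    have h3 : (2 : CliffordAlgebra Q) = 0 := by
      rw [← one_add_one_eq_two]; nth_rewrite 2 [h]; simp
    rw [h3] at h2
    exact not_isUnit_zero h2
  · intro i
    rw [CliffordAlgebra.ι_sq_scalar, hQ, Finset.sum_eq_single i]
    · simp
    · intro j _ hj; simp [hj]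
    · simp
  · intro i j hij
    apply CliffordAlgebra.ι_mul_ι_comm_of_isOrtho
    rw [QuadraticMap.isOrtho_def, hQ, hQ, hQ, ← Finset.sum_add_distrib]
    apply Finset.sum_congr rfl
    intro k _
    by_cases h1 : k = i
    · subst h1; simp [hij]
    · simp [h1]
  · intro u hu v
    induction v using CliffordAlgebra.induction with
    | algebraMap r => exact (Algebra.commutes r u).symm
    | ι x =>
      have : x = ∑ i, x i • (Pi.single i 1 : Fin n → ℚ) := by
        ext k; simp [Finset.sum_apply, Pi.single_apply]
      rw [this, map_sum, Finset.mul_sum, Finset.sum_mul]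
      apply Finset.sum_congr rfl
      intro i _
      rw [map_smul, mul_smul_comm, smul_mul_assoc, hu]
    | mul a b ha hb => rw [← mul_assoc, ha, mul_assoc, hb, mul_assoc]
    | add a b ha hb => rw [mul_add, add_mul, ha, hb]

theorem alt_nontriv (n : ℕ) (hn : 8 ≤ n) :
    ∃ f : Alt n → Alt n → AddCircle (1 : ℚ),
      (∀ g h j, f (g * h) j + f g h = f h j + f g (h * j)) ∧
      ¬ ∃ c : Alt n → AddCircle (1 : ℚ), ∀ g h, f g h = c h - c (g * h) + c g := by
  obtain ⟨B, _, e, h1, h2, hsq, hac, hcen⟩ := cliff_exists n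
  -- lifts of transpositions
  have hsw : ∀ a b : Fin n, a ≠ b → ∃ u : Bˣ, (u : B) = e a - e b ∧
      ∀ i, (u : B) * e i = - (e (Equiv.swap a b i) * u) := by
    intro a b hab
    have hu2 : (e a - e b) * (e a - e b) = 2 := by
      rw [sub_mul, mul_sub, mul_sub, hsq, hsq, hac a b hab, ← one_add_one_eq_two]; abel
    obtain ⟨t, ht⟩ := h2
    have hu : IsUnit (e a - e b) := by
      have ht' : (e a - e b) * ((e a - e b) * (t⁻¹ : Bˣ)) = 1 := by
        rw [← mul_assoc, hu2, ← ht]; simp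
      have ht2 : ((t⁻¹ : Bˣ) * (e a - e b)) * (e a - e b) = 1 := by
        rw [mul_assoc, hu2, ← ht]; simp
      exact isUnit_iff_exists_and_exists.2 ⟨⟨_, ht'⟩, ⟨_, ht2⟩⟩
    obtain ⟨u, hu⟩ := hu
    refine ⟨u, hu, ?_⟩
    intro i
    rw [hu]
    by_cases hia : i = a
    · subst hia
      rw [Equiv.swap_apply_left, sub_mul, mul_sub, hsq, hsq]; abel
    · by_cases hib : i = b
      · subst hib
        rw [Equiv.swap_apply_right, sub_mul, mul_sub, hsq, hsq]; abel
      · rw [Equiv.swap_apply_of_ne_of_ne hia hib, sub_mul, mul_sub, hac i a hia, hac i b hib]; abel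
  -- lifts of all permutations
  have hall : ∀ g : Equiv.Perm (Fin n), ∃ u : Bˣ, ∀ i,
      (u : B) * e i = ((Equiv.Perm.sign g : ℤ) : B) * (e (g i) * u) := by
    intro g
    induction g using Equiv.Perm.swap_induction_on with
    | one => exact ⟨1, fun i => by simp⟩
    | swap_mul g a b hab ih =>
      obtain ⟨v, hv⟩ := ih
      obtain ⟨u, -, hu⟩ := hsw a b hab
      refine ⟨u * v, fun i => ?_⟩
      rw [Units.val_mul, mul_assoc, hv, Equiv.Perm.sign_mul, Equiv.Perm.sign_swap hab,
        ← mul_assoc (u : B), ← (Int.cast_commute _ (u : B)).eq, mul_assoc, ← mul_assoc (u : B), hu]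
      simp [mul_assoc]
  let Γ : Subgroup (Bˣ × Alt n) :=
    { carrier := {x | ∀ i, (x.1 : B) * e i = e (x.2.1 i) * x.1}
      one_mem' := fun i => by simp
      mul_mem' := by
        intro x y hx hy i
        change ((x.1 * y.1 : Bˣ) : B) * e i = e (x.2.1 (y.2.1 i)) * ((x.1 * y.1 : Bˣ) : B)
        rw [Units.val_mul, mul_assoc, hy, ← mul_assoc, hx, mul_assoc]
      inv_mem' := by
        intro x hx i
        change ((x.1⁻¹ : Bˣ) : B) * e i = e (x.2.1⁻¹ i) * ((x.1⁻¹ : Bˣ) : B)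
        have := hx (x.2.1⁻¹ i)
        rw [show x.2.1 (x.2.1⁻¹ i) = i from Equiv.apply_symm_apply _ _] at this
        rw [Units.inv_mul_eq_iff_eq_mul, ← mul_assoc, this, mul_assoc, Units.mul_inv, mul_one] }
  let π : Γ →* Alt n := (MonoidHom.snd _ _).comp Γ.subtype
  have hπs : Function.Surjective π := by
    intro g
    obtain ⟨u, hu⟩ := hall g.1
    refine ⟨⟨(u, g), fun i => ?_⟩, rfl⟩
    have hg : Equiv.Perm.sign g.1 = 1 := g.2
    simpa [hg] using hu i
  have hπk : π.ker ≤ Subgroup.center Γ := by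
    intro x hx
    rw [Subgroup.mem_center_iff]
    intro y
    have hx2 : x.1.2 = 1 := hx
    have hxe : ∀ i, (x.1.1 : B) * e i = e i * x.1.1 := fun i => by
      have := x.2 i
      rw [hx2] at this
      exact this
    apply Subtype.ext
    apply Prod.ext
    · exact Units.ext (hcen _ hxe _).symm
    · change y.1.2 * x.1.2 = x.1.2 * y.1.2
      rw [hx2, one_mul, mul_one]
  -- the two commuting involutions
  let i0 : Fin n := ⟨0, by omega⟩
  let i1 : Fin n := ⟨1, by omega⟩
  let i2 : Fin n := ⟨2, by omega⟩
  let i3 : Fin n := ⟨3, by omega⟩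
  have n01 : i0 ≠ i1 := by simp [i0, i1]
  have n02 : i0 ≠ i2 := by simp [i0, i2]
  have n03 : i0 ≠ i3 := by simp [i0, i3]
  have n12 : i1 ≠ i2 := by simp [i1, i2]
  have n13 : i1 ≠ i3 := by simp [i1, i3]
  have n23 : i2 ≠ i3 := by simp [i2, i3]
  obtain ⟨u, hu, hu'⟩ := hsw i0 i1 n01
  obtain ⟨v, hv, hv'⟩ := hsw i2 i3 n23
  let a : Alt n := ⟨Equiv.swap i0 i1 * Equiv.swap i2 i3, by
    rw [Equiv.Perm.mem_alternatingGroup, Equiv.Perm.sign_mul, Equiv.Perm.sign_swap n01,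
      Equiv.Perm.sign_swap n23]; simp⟩
  let b : Alt n := ⟨Equiv.swap i0 i2 * Equiv.swap i1 i3, by
    rw [Equiv.Perm.mem_alternatingGroup, Equiv.Perm.sign_mul, Equiv.Perm.sign_swap n02,
      Equiv.Perm.sign_swap n13]; simp⟩
  have b0 : b.1 i0 = i2 := by
    change Equiv.swap i0 i2 (Equiv.swap i1 i3 i0) = i2
    rw [Equiv.swap_apply_of_ne_of_ne n01 n03, Equiv.swap_apply_left]
  have b2 : b.1 i2 = i0 := by
    change Equiv.swap i0 i2 (Equiv.swap i1 i3 i2) = i0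
    rw [Equiv.swap_apply_of_ne_of_ne n12.symm n23, Equiv.swap_apply_right]
  have b1 : b.1 i1 = i3 := by
    change Equiv.swap i0 i2 (Equiv.swap i1 i3 i1) = i3
    rw [Equiv.swap_apply_left, Equiv.swap_apply_of_ne_of_ne n03.symm n23.symm]
  have b3 : b.1 i3 = i1 := by
    change Equiv.swap i0 i2 (Equiv.swap i1 i3 i3) = i1
    rw [Equiv.swap_apply_right, Equiv.swap_apply_of_ne_of_ne n01.symm n12]
  let x : Γ := ⟨(u * v, a), fun i => by
    change ((u * v : Bˣ) : B) * e i = e (Equiv.swap i0 i1 (Equiv.swap i2 i3 i)) * ((u * v : Bˣ) : B)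
    rw [Units.val_mul, mul_assoc, hv', mul_neg, ← mul_assoc, hu', neg_mul, neg_neg, mul_assoc]⟩
  obtain ⟨y, hy⟩ := hπs b
  let w : Γ := ⟨(-1, 1), fun i => by simp⟩
  have hye : ∀ i, (y.1.1 : B) * e i = e (b.1 i) * y.1.1 := fun i => by
    have := y.2 i
    rw [show y.1.2 = b from hy] at this
    exact this
  have hyu : (y.1.1 : B) * u = v * y.1.1 := by
    rw [hu, hv, mul_sub, sub_mul, hye, hye, b0, b1]
  have hyv : (y.1.1 : B) * v = u * y.1.1 := by
    rw [hu, hv, mul_sub, sub_mul, hye, hye, b2, b3]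
  have huv : (v : B) * u = - (u * v) := by
    rw [hu, mul_sub, hv', hv', Equiv.swap_apply_of_ne_of_ne n02 n03,
      Equiv.swap_apply_of_ne_of_ne n12 n13, sub_mul]
    abel
  refine ext_nontriv π hπs hπk x y w ?_ rfl ?_
  · apply Subtype.ext
    apply Prod.ext
    · apply Units.ext
      change (u : B) * v * y.1.1 = -1 * ((y.1.1 : B) * ((u : B) * v))
      rw [← mul_assoc (y.1.1 : B), hyu, mul_assoc (v : B), hyv, ← mul_assoc (v : B), huv]
      simp
    · change a * y.1.2 = 1 * (y.1.2 * a)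
      rw [one_mul, show y.1.2 = b from hy]
      apply Subtype.ext
      change Equiv.swap i0 i1 * Equiv.swap i2 i3 * b.1 = b.1 * (Equiv.swap i0 i1 * Equiv.swap i2 i3)
      rw [← mul_assoc b.1, Equiv.mul_swap_eq_swap_mul b.1, b0, b1, mul_assoc _ b.1,
        Equiv.mul_swap_eq_swap_mul b.1, b2, b3, ← mul_assoc,
        Equiv.mul_swap_eq_swap_mul (Equiv.swap i0 i1),
        Equiv.swap_apply_of_ne_of_ne n02.symm n12.symm,
        Equiv.swap_apply_of_ne_of_ne n03.symm n13.symm]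
      simp only [mul_assoc]
      rfl
  · intro h
    have := congrArg (fun t : Γ => (t.1.1 : B)) h
    exact h1 (by simpa [w] using this.symm)

theorem snocN {G : Type} (n : ℕ) (g : Fin n → G) (x : G) (k : Fin (n + 1)) :
    (Fin.snoc g x : Fin (n + 1) → G) k = if h : k.1 < n then g ⟨k.1, h⟩ else x := by
  simp [Fin.snoc, Fin.castLT]

theorem contract_snoc_lt {G : Type} [Group G] (n : ℕ) (g : Fin (n + 1) → G) (x : G) (j : Fin n) :
    Fin.contractNth j.castSucc.castSucc (· * ·) (Fin.snoc g x : Fin (n + 2) → G) =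
      (Fin.snoc (Fin.contractNth j.castSucc (· * ·) g) x : Fin (n + 1) → G) := by
  ext ⟨k, hk⟩
  obtain ⟨j, hj⟩ := j
  simp only [Fin.contractNth, snocN, Fin.castSucc_mk, Fin.succ_mk]
  split_ifs <;> first | rfl | omega

theorem contract_snoc_eq {G : Type} [Group G] (n : ℕ) (g : Fin (n + 1) → G) (x : G) :
    Fin.contractNth (Fin.last n).castSucc (· * ·) (Fin.snoc g x : Fin (n + 2) → G) =
      (Fin.snoc (Fin.contractNth (Fin.last n) (· * ·) g) (g (Fin.last n) * x) : Fin (n + 1) → G) := by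
  ext ⟨k, hk⟩
  simp only [Fin.contractNth, snocN, Fin.val_castSucc, Fin.val_last, Fin.castSucc_mk, Fin.succ_mk]
  split_ifs <;> first | rfl | omega | skip
  congr 2
  ext; simp; omega

theorem contract_snoc_last {G : Type} [Group G] (n : ℕ) (g : Fin (n + 1) → G) (x : G) :
    Fin.contractNth (Fin.last (n + 1)) (· * ·) (Fin.snoc g x : Fin (n + 2) → G) = g := by
  ext ⟨k, hk⟩
  simp only [Fin.contractNth, snocN, Fin.val_castSucc, Fin.val_last, Fin.castSucc_mk, Fin.succ_mk]
  simp [hk]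

theorem snoc_succ {G : Type} [Group G] (n : ℕ) (g : Fin (n + 1) → G) (x : G) :
    (fun i : Fin (n + 1) => (Fin.snoc g x : Fin (n + 2) → G) i.succ) =
      (Fin.snoc (fun i : Fin n => g i.succ) x : Fin (n + 1) → G) := by
  ext ⟨k, hk⟩
  simp only [snocN, Fin.succ_mk]
  split_ifs <;> first | rfl | omega

theorem avg {G : Type} [Group G] [Fintype G] (n : ℕ) (f : (Fin (n + 1) → G) → ℚ)
    (hf : inhomogeneousCochains.d (Rep.trivial ℤ G ℚ) (n + 1) f = 0) :
    ∃ h : (Fin n → G) → ℚ, inhomogeneousCochains.d (Rep.trivial ℤ G ℚ) n h = f := by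
  have hd : ∀ (m : ℕ) (f : (Fin m → G) → ℚ) g, inhomogeneousCochains.d (Rep.trivial ℤ G ℚ) m f g =
      f (fun i => g i.succ) + ∑ j : Fin (m + 1), (-1 : ℤ) ^ ((j : ℕ) + 1) • f (Fin.contractNth j (· * ·) g) :=
    fun m f g => rfl
  refine ⟨fun g => (-1) ^ (n + 1) * ((Fintype.card G : ℚ)⁻¹ * ∑ x, f (Fin.snoc g x)), ?_⟩
  have hf' := fun g => (hd (n + 1) f g).symm.trans (congrFun hf g)
  funext g
  rw [hd]
  have h1 : ∑ x : G, f (Fin.snoc (Fin.contractNth (Fin.last n) (· * ·) g) (g (Fin.last n) * x)) =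
      ∑ x : G, f (Fin.snoc (Fin.contractNth (Fin.last n) (· * ·) g) x) :=
    Fintype.sum_equiv (Equiv.mulLeft (g (Fin.last n))) _ _ (fun x => rfl)
  have h2 : ∑ x : G, (f (Fin.snoc (fun i : Fin n => g i.succ) x) +
      ((∑ j : Fin n, (-1 : ℤ) ^ ((j : ℕ) + 1) • f (Fin.snoc (Fin.contractNth j.castSucc (· * ·) g) x)) +
        (-1 : ℤ) ^ (n + 1) • f (Fin.snoc (Fin.contractNth (Fin.last n) (· * ·) g) (g (Fin.last n) * x))
        + (-1 : ℤ) ^ (n + 2) • f g)) = 0 := by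
    apply Finset.sum_eq_zero
    intro x _
    have := hf' (Fin.snoc g x)
    rw [snoc_succ, Fin.sum_univ_castSucc, Fin.sum_univ_castSucc, contract_snoc_last,
      contract_snoc_eq] at this
    simp only [contract_snoc_lt] at this
    exact this
  rw [Finset.sum_add_distrib, Finset.sum_add_distrib, Finset.sum_add_distrib, ← Finset.smul_sum, h1,
    Finset.sum_comm, Finset.sum_const, Finset.card_univ] at h2
  simp only [← Finset.smul_sum] at h2
  rw [Fin.sum_univ_castSucc]
  simp only [← mul_smul_comm, ← Finset.mul_sum]
  rw [← mul_add, ← mul_add, ← mul_add, ← mul_add]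
  have hN : (Fintype.card G : ℚ) ≠ 0 := by exact_mod_cast Fintype.card_ne_zero
  rw [← add_assoc, ← eq_neg_iff_add_eq_zero] at h2
  simp only [Fin.val_castSucc, Fin.val_last]
  rw [h2]
  have hc : ((-1 : ℚ) ^ n) ^ 2 = 1 := by rw [← pow_mul, mul_comm, pow_mul]; simp
  simp only [nsmul_eq_mul, zsmul_eq_mul]
  push_cast
  rw [pow_add, pow_add]
  generalize (-1 : ℚ) ^ n = c at hc
  field_simp
  linear_combination (f g) * hc

theorem isZero_Q {G : Type} [Group G] [Finite G] (n : ℕ) :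
    Limits.IsZero (groupCohomology (Rep.trivial ℤ G ℚ) (n + 1)) := by
  have := Fintype.ofFinite G
  rw [ModuleCat.isZero_iff_subsingleton]
  refine subsingleton_of_forall_eq 0 fun x => ?_
  induction x using groupCohomology_induction_on with | h x => ?_
  obtain ⟨h, hh⟩ := avg n (groupCohomology.iCocycles _ _ x) (by
    have := congrArg (fun φ => φ.hom x) (HomologicalComplex.iCycles_d
      (groupCohomology.inhomogeneousCochains (Rep.trivial ℤ G ℚ)) (n + 1) (n + 2))
    rw [groupCohomology.inhomogeneousCochains.d_def] at this
    exact this)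
  have : x = groupCohomology.toCocycles (Rep.trivial ℤ G ℚ) n (n + 1) h := by
    apply (ModuleCat.mono_iff_injective (groupCohomology.iCocycles _ _)).1 inferInstance
    have := congrArg (fun φ => φ.hom h) (HomologicalComplex.toCycles_i
      (groupCohomology.inhomogeneousCochains (Rep.trivial ℤ G ℚ)) n (n + 1))
    rw [groupCohomology.inhomogeneousCochains.d_def] at this
    rw [← hh]
    exact this.symm
  rw [this]
  exact congrArg (fun φ => φ.hom h) (HomologicalComplex.toCycles_comp_homologyπ
    (groupCohomology.inhomogeneousCochains (Rep.trivial ℤ G ℚ)) n (n + 1))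

theorem rep_exact {k G : Type} [CommRing k] [Group G] (S : ShortComplex (Rep.{0} k G))
    (h : ∀ x : S.X₂, S.g.hom x = 0 → ∃ y : S.X₁, S.f.hom y = x) : S.Exact := by
  apply (forget₂ (Rep.{0} k G) (ModuleCat k)).reflects_exact_of_faithful
  rw [ShortComplex.moduleCat_exact_iff]
  exact h

/-- The sequence `ℤ → ℚ → ℚ/ℤ` of trivial representations. -/
def seqQZ (G : Type) [Group G] : ShortComplex (Rep ℤ G) where
  X₁ := Rep.trivial ℤ G ℤ
  X₂ := Rep.trivial ℤ G ℚ
  X₃ := Rep.trivial ℤ G (AddCircle (1 : ℚ))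
  f := Rep.ofHom ⟨(Int.castAddHom ℚ).toIntLinearMap, fun _ => rfl⟩
  g := Rep.ofHom ⟨(QuotientAddGroup.mk' (AddSubgroup.zmultiples (1 : ℚ))).toIntLinearMap, fun _ => rfl⟩
  zero := by
    ext
    change (((1 : ℤ) : ℚ) : AddCircle (1 : ℚ)) = 0
    rw [AddCircle.coe_eq_zero_iff]
    exact ⟨1, by simp⟩

theorem seqQZ_exact (G : Type) [Group G] : (seqQZ G).ShortExact where
  exact := by
    apply rep_exact
    intro (x : ℚ) hx
    have hx : (x : AddCircle (1 : ℚ)) = 0 := hx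
    rw [AddCircle.coe_eq_zero_iff] at hx
    obtain ⟨n, hn⟩ := hx
    refine ⟨n, ?_⟩
    change (n : ℚ) = x
    rw [← hn]; simp
  mono_f := (Rep.mono_iff_injective _).2 fun x y h => Int.cast_injective (α := ℚ) h
  epi_g := (Rep.epi_iff_surjective _).2 fun x => QuotientAddGroup.mk_surjective x

theorem H3_iso (G : Type) [Group G] [Finite G] :
    Nonempty (groupCohomology (Rep.trivial ℤ G (AddCircle (1 : ℚ))) 2 ≃+
      groupCohomology (Rep.trivial ℤ G ℤ) 3) := by
  have := groupCohomology.isIso_δ_of_isZero (seqQZ_exact G) 2 (isZero_Q 1) (isZero_Q 2)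
  exact ⟨(asIso (groupCohomology.δ (seqQZ_exact G) 2 3 rfl)).toLinearEquiv.toAddEquiv⟩

theorem H2_card (n : ℕ) (hn : 8 ≤ n) :
    Nat.card (groupCohomology (Rep.trivial ℤ (Alt n) (AddCircle (1 : ℚ))) 2) = 2 := by
  obtain ⟨f, hf, hfn⟩ := alt_nontriv n hn
  let A := Rep.trivial ℤ (Alt n) (AddCircle (1 : ℚ))
  have hcob : ∀ f : Alt n × Alt n → AddCircle (1 : ℚ), f ∈ groupCohomology.coboundaries₂ A ↔
      ∃ c : Alt n → AddCircle (1 : ℚ), ∀ g h, f (g, h) = c h - c (g * h) + c g := by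
    intro f
    constructor
    · rintro ⟨c, hc⟩
      exact ⟨c, fun g h => (congrFun hc (g, h)).symm⟩
    · rintro ⟨c, hc⟩
      exact ⟨c, funext fun x => (hc x.1 x.2).symm⟩
  let F : groupCohomology.cocycles₂ A := ⟨fun x => f x.1 x.2,
    (groupCohomology.mem_cocycles₂_iff (A := A) _).2 hf⟩
  rw [Nat.card_eq_two_iff]
  refine ⟨0, groupCohomology.H2π A F, ?_, ?_⟩
  · intro h
    have h := (groupCohomology.H2π_eq_zero_iff F).1 h.symm
    exact hfn ((hcob _).1 h)
  · rw [Set.eq_univ_iff_forall]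
    intro x
    induction x using groupCohomology.H2_induction_on with | h x => ?_
    have hx := (groupCohomology.mem_cocycles₂_iff (A := A) _).1 x.2
    rcases cocycle_two (by simpa using hn) (fun g h => x.1 (g, h)) f hx hf with h | h | h
    · left
      exact (groupCohomology.H2π_eq_zero_iff x).2 ((hcob _).2 h)
    · exact absurd h hfn
    · right
      exact (groupCohomology.H2π_eq_iff x F).2 ((hcob _).2 h)

/-- For every integer `n ≥ 8`, `H³(𝔄ₙ, ℤ_triv) ≅ ℤ/2ℤ`. -/
theorem stmt_2 (n : ℕ) (hn : 8 ≤ n) :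
    Nonempty ((groupCohomology (Rep.trivial ℤ (Alt n) ℤ) 3) ≃+ ZMod 2) := by
  obtain ⟨e⟩ := H3_iso (Alt n)
  have hc := H2_card n hn
  have : Fact (Nat.Prime 2) := ⟨Nat.prime_two⟩
  have hcyc : IsAddCyclic (groupCohomology (Rep.trivial ℤ (Alt n) (AddCircle (1 : ℚ))) 2) :=
    isAddCyclic_of_prime_card hc
  have e2 := zmodAddCyclicAddEquiv hcyc
  rw [hc] at e2
  exact ⟨e.symm.trans e2.symm⟩
end
end

section
/- The third group cohomology of the alternating group with trivial integer coefficients satisfies H^3(𝔄_3, ℤ_triv) = 0, H^3(𝔄_4, ℤ_triv) ≅ ℤ/2ℤ, and H^3(𝔄_5, ℤ_triv) ≅ ℤ/2ℤ. -/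
open CategoryTheory

noncomputable section

namespace AltCoh
abbrev HZ (G : Type) [Group G] (M : Type) [AddCommGroup M] (n : ℕ) :=
  groupCohomology (Rep.trivial ℤ G M) n

def iMap {G : Type} [Group G] (H : Subgroup G) (M : Type) [AddCommGroup M] :
    Rep.trivial ℤ G M ⟶ Rep.coind H.subtype (Rep.trivial ℤ H M) :=
  Rep.ofHom
    { toFun := fun m => ⟨fun _ => m, fun _ _ => rfl⟩
      map_add' := fun _ _ => rfl
      map_smul' := fun _ _ => rfl
      isIntertwining' := fun _ => rfl }

def tMap {G : Type} [Group G] (H : Subgroup G) [Fintype (G ⧸ H)] (M : Type) [AddCommGroup M] :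
    Rep.coind H.subtype (Rep.trivial ℤ H M) ⟶ Rep.trivial ℤ G M :=
  Rep.ofHom
    { toFun := fun f => ∑ q : G ⧸ H, f.1 (q.out⁻¹)
      map_add' := fun f g => Finset.sum_add_distrib
      map_smul' := fun c f => (Finset.smul_sum (r := c) (f := fun q : G ⧸ H => f.1 (q.out⁻¹)) (s := Finset.univ)).symm
      isIntertwining' := fun g => by
        ext f
        change ∑ q : G ⧸ H, f.1 (q.out⁻¹ * g) = ∑ q : G ⧸ H, f.1 (q.out⁻¹)
        refine Fintype.sum_equiv (MulAction.toPerm g⁻¹) _ _ fun q => ?_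
        simp only [MulAction.toPerm_apply]
        have h1 : (QuotientGroup.mk ((g⁻¹ • q).out) : G ⧸ H) = QuotientGroup.mk (g⁻¹ * q.out) := by
          rw [QuotientGroup.out_eq']
          conv_lhs => rw [← QuotientGroup.out_eq' q]
          rfl
        have h2 := QuotientGroup.eq.1 h1
        have h3 := f.2 ⟨_, h2⟩ ((g⁻¹ * q.out)⁻¹)
        simp only [Subgroup.coe_subtype] at h3
        have h4 : f.1 ((g⁻¹ • q).out⁻¹) = f.1 ((g⁻¹ * q.out)⁻¹) := by
          refine Eq.trans ?_ h3
          group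
        rw [h4]
        group }

lemma hom_nsmul_id {G : Type} [Group G] (A : Rep ℤ G) (k : ℕ) (x : A) :
    (k • 𝟙 A : A ⟶ A).hom x = k • x := by
  induction k with
  | zero => rw [zero_smul, zero_smul]; rfl
  | succ k ih => rw [succ_nsmul, succ_nsmul, ← ih]; rfl

lemma i_t {G : Type} [Group G] (H : Subgroup G) [Fintype (G ⧸ H)] (M : Type) [AddCommGroup M] :
    iMap H M ≫ tMap H M = H.index • 𝟙 (Rep.trivial ℤ G M) := by
  ext m
  refine Eq.trans ?_ (hom_nsmul_id (Rep.trivial ℤ G M) H.index m).symm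
  change ∑ q : G ⧸ H, m = _
  rw [Finset.sum_const, Finset.card_univ, ← Nat.card_eq_fintype_card]
  rfl

lemma map_nsmul_id {G : Type} [Group G] (A : Rep ℤ G) (n k : ℕ) (x : groupCohomology A n) :
    groupCohomology.map (MonoidHom.id G) (k • 𝟙 A) n x = k • x := by
  have : groupCohomology.map (MonoidHom.id G) (k • 𝟙 A) n = k • 𝟙 (groupCohomology A n) := by
    have h : (groupCohomology.cochainsFunctor ℤ G ⋙ HomologicalComplex.homologyFunctor _ _ n).map (k • 𝟙 A) = k • (𝟙 _) := by
      rw [Functor.map_nsmul, CategoryTheory.Functor.map_id]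
    exact h
  rw [this]
  simp

/-- Transfer argument. -/
lemma transfer {G : Type} [Group G] [Finite G] (H : Subgroup G) (M : Type) [AddCommGroup M]
    (n : ℕ) (x : HZ G M n) (hx : groupCohomology.map (MonoidHom.id G) (iMap H M) n x = 0) :
    H.index • x = 0 := by
  have : Fintype (G ⧸ H) := Fintype.ofFinite _
  rw [← map_nsmul_id, ← i_t, groupCohomology.map_id_comp, ModuleCat.comp_apply, hx, map_zero]

lemma transfer' {G : Type} [Group G] [Finite G] (H : Subgroup G) (M : Type) [AddCommGroup M]
    (n : ℕ) (h : Subsingleton (HZ H M n)) (x : HZ G M n)  :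
    H.index • x = 0 := by
  apply transfer
  apply (groupCohomology.coindIso (Rep.trivial ℤ H M) n).toLinearEquiv.injective
  exact h.elim _ _

lemma rat_zero {G : Type} [Group G] [Finite G] (n : ℕ) : Subsingleton (HZ G ℚ (n + 1)) := by
  refine subsingleton_of_forall_eq 0 fun x => ?_
  have h0 : Subsingleton (HZ (⊥ : Subgroup G) ℚ (n+1)) :=
    ModuleCat.subsingleton_of_isZero (isZero_groupCohomology_succ_of_subsingleton _ _)
  have h1 := fun x => transfer' (⊥ : Subgroup G) ℚ (n+1) h0 x
  rw [Subgroup.index_bot] at h1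
  have hc : (Nat.card G : ℚ) ≠ 0 := by exact_mod_cast Nat.card_pos.ne'
  let s : Rep.trivial ℤ G ℚ ⟶ Rep.trivial ℤ G ℚ := Rep.ofHom
    { toFun := fun m => (Nat.card G : ℚ)⁻¹ * m
      map_add' := fun _ _ => mul_add _ _ _
      map_smul' := fun c m => by simp; ring
      isIntertwining' := fun _ => rfl }
  have hs : s ≫ (Nat.card G • 𝟙 _) = 𝟙 _ := by
    ext m
    refine Eq.trans (hom_nsmul_id (Rep.trivial ℤ G ℚ) (Nat.card G) (s.hom m)) ?_
    change Nat.card G • ((Nat.card G : ℚ)⁻¹ * (show ℚ from m)) = (show ℚ from m)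
    rw [nsmul_eq_mul, mul_inv_cancel_left₀ hc]
  have : groupCohomology.map (MonoidHom.id G) (s ≫ (Nat.card G • 𝟙 _)) (n+1) x = x := by
    rw [hs, groupCohomology.map_id]; rfl
  rw [← this, groupCohomology.map_id_comp, ModuleCat.comp_apply, map_nsmul_id, h1]

lemma cyc_zero {G : Type} [Group G] [Finite G] (g : G) (hg : ∀ x, x ∈ Subgroup.zpowers g) :
    Subsingleton (HZ G ℤ 3) := by
  let _ : CommGroup G := { (inferInstance : Group G) with
    mul_comm := fun x y => by
      obtain ⟨i, rfl⟩ := hg x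
      obtain ⟨j, rfl⟩ := hg y
      simp only [← zpow_add, add_comm] }
  have : Fintype G := Fintype.ofFinite _
  let S := (Rep.FiniteCyclicGroup.subCompNormHom (Rep.trivial ℤ G ℤ) g)
  have e := Rep.FiniteCyclicGroup.groupCohomologyIsoOdd (Rep.trivial ℤ G ℤ) g hg 3 (by decide)
  have hS : S.Exact := by
    rw [ShortComplex.moduleCat_exact_iff]
    intro x hx
    refine ⟨0, ?_⟩
    rw [map_zero]
    replace hx : (Rep.trivial ℤ G ℤ).norm.hom x = 0 := hx
    have : (Rep.trivial ℤ G ℤ).norm.hom x = (Fintype.card G : ℤ) * (show ℤ from x) := by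
      simp [Rep.norm, Representation.norm]
    have hx' : (Fintype.card G : ℤ) * (show ℤ from x) = 0 := this.symm.trans hx
    have := (mul_eq_zero.1 hx').resolve_left (by exact_mod_cast (Fintype.card_ne_zero (α := G)))
    exact this.symm
  have hz := (ShortComplex.exact_iff_isZero_homology _).1 hS
  exact ModuleCat.subsingleton_of_isZero (hz.of_iso e)

lemma cyc_index {G : Type} [Group G] [Finite G] (g : G) (x : HZ G ℤ 3) :
    (Subgroup.zpowers g).index • x = 0 := by
  apply transfer'
  apply cyc_zero (⟨g, Subgroup.mem_zpowers g⟩ : Subgroup.zpowers g)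
  rintro ⟨_, k, rfl⟩
  exact ⟨k, Subtype.ext rfl⟩

abbrev QZ := AddCircle (1 : ℚ)

lemma QZ_half (x : QZ) : ∃ y : QZ, y + y = x := by
  induction x using QuotientAddGroup.induction_on with
  | H q => exact ⟨((q / 2 : ℚ) : QZ), by rw [← AddCircle.coe_add, add_halves]⟩

abbrev hf : QZ := ((1 / 2 : ℚ) : QZ)

lemma hf_add : hf + hf = 0 := by
  rw [← AddCircle.coe_add, add_halves]; exact AddCircle.coe_period 1

lemma hf_ne : hf ≠ 0 := by
  intro h
  rw [hf, AddCircle.coe_eq_zero_iff] at h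
  obtain ⟨n, hn⟩ := h
  have h2 : ((2 * n : ℤ) : ℚ) = ((1 : ℤ) : ℚ) := by
    push_cast
    simp at hn
    linarith
  have := Int.cast_injective h2
  omega

lemma QZ_two (x : QZ) (hx : x + x = 0) : x = 0 ∨ x = hf := by
  induction x using QuotientAddGroup.induction_on with
  | H q =>
    change ((q : ℚ) : QZ) + ((q : ℚ) : QZ) = 0 at hx
    rw [← AddCircle.coe_add, AddCircle.coe_eq_zero_iff] at hx
    obtain ⟨n, hn⟩ := hx
    have hq : q = n / 2 := by simp at hn; linarith
    rcases Int.even_or_odd' n with ⟨k, rfl | rfl⟩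
    · left
      refine (AddCircle.coe_eq_zero_iff 1).2 ⟨k, ?_⟩
      rw [hq]; push_cast; simp
    · right
      change ((q : ℚ) : QZ) = _
      rw [hq, hf, ← sub_eq_zero, ← AddCircle.coe_sub, AddCircle.coe_eq_zero_iff]
      exact ⟨k, by push_cast; simp; ring⟩

def seqZQ (G : Type) [Group G] : ShortComplex (Rep ℤ G) where
  X₁ := Rep.trivial ℤ G ℤ
  X₂ := Rep.trivial ℤ G ℚ
  X₃ := Rep.trivial ℤ G QZ
  f := Rep.ofHom
    { toFun := fun m => (m : ℚ)
      map_add' := fun _ _ => Int.cast_add _ _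
      map_smul' := fun c m => by simp
      isIntertwining' := fun _ => rfl }
  g := Rep.ofHom
    { toFun := fun m => (m : QZ)
      map_add' := fun _ _ => rfl
      map_smul' := fun c m => rfl
      isIntertwining' := fun _ => rfl }
  zero := by
    refine Rep.hom_ext (DFunLike.ext _ _ fun m : ℤ => ?_)
    change (((m : ℤ) : ℚ) : QZ) = 0
    exact (AddCircle.coe_eq_zero_iff 1).2 ⟨m, by simp⟩

lemma rep_exact {k G : Type} [CommRing k] [Group G] (X : ShortComplex (Rep.{0} k G))
    (h : ∀ x, X.g.hom x = 0 → ∃ y, X.f.hom y = x) : X.Exact := by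
  refine (ShortComplex.exact_map_iff_of_faithful X
      (forget₂ (Rep.{0} k G) (ModuleCat.{0} k))).1 ?_
  rw [ShortComplex.moduleCat_exact_iff]
  exact h

lemma seqZQ_exact (G : Type) [Group G] : (seqZQ G).ShortExact where
  exact := by
    apply rep_exact
    intro (q : ℚ) (hq : (q : QZ) = 0)
    obtain ⟨n, hn⟩ := (AddCircle.coe_eq_zero_iff 1).1 hq
    refine ⟨n, ?_⟩
    change ((n : ℤ) : ℚ) = q
    simpa using hn
  mono_f := (Rep.mono_iff_injective _).2 fun x y h => Int.cast_injective (α := ℚ) h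
  epi_g := (Rep.epi_iff_surjective _).2 fun x => by
    obtain ⟨q, hq⟩ := QuotientAddGroup.mk_surjective x
    exact ⟨q, hq⟩

lemma shift (G : Type) [Group G] [Finite G] : Nonempty (HZ G QZ 2 ≃+ HZ G ℤ 3) := by
  have h2 : Limits.IsZero (groupCohomology (seqZQ G).X₂ 2) := by
    have := rat_zero (G := G) 1
    exact ModuleCat.isZero_of_subsingleton (HZ G ℚ 2)
  have h3 : Limits.IsZero (groupCohomology (seqZQ G).X₂ (2 + 1)) := by
    have := rat_zero (G := G) 2
    exact ModuleCat.isZero_of_subsingleton (HZ G ℚ 3)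
  have := groupCohomology.isIso_δ_of_isZero (seqZQ_exact G) 2 h2 h3
  exact ⟨(asIso (groupCohomology.δ (seqZQ_exact G) 2 3 rfl)).toLinearEquiv.toAddEquiv⟩

section V
variable {G : Type} [Group G] (a b : G)

structure Klein : Prop where
  aa : a * a = 1
  bb : b * b = 1
  comm : a * b = b * a
  a1 : a ≠ 1
  b1 : b ≠ 1
  ab : a ≠ b

variable {a b}

lemma coc_eq (f : groupCohomology.cocycles₂ (Rep.trivial ℤ G QZ)) (g h j : G) :
    f (g * h, j) + f (g, h) = f (h, j) + f (g, h * j) :=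
  (groupCohomology.mem_cocycles₂_iff f.1).1 f.2 g h j

lemma cob_iff (f : G × G → QZ) : f ∈ groupCohomology.coboundaries₂ (Rep.trivial ℤ G QZ) ↔
    ∃ u : G → QZ, ∀ g h, u h - u (g * h) + u g = f (g, h) :=
  ⟨fun ⟨u, hu⟩ => ⟨u, fun g h => congrFun hu (g, h)⟩,
    fun ⟨u, hu⟩ => ⟨u, funext fun p => hu p.1 p.2⟩⟩

lemma klein_tors (K : Klein a b) (f : groupCohomology.cocycles₂ (Rep.trivial ℤ G QZ)) :
    (f (a, b) - f (b, a) : QZ) + (f (a, b) - f (b, a)) = 0 := by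
  have h1 := coc_eq f a a b
  have h2 := coc_eq f b a a
  have h3 := coc_eq f a b a
  have h4 := coc_eq f 1 1 b
  have h5 := coc_eq f b 1 1
  simp only [K.aa, ← K.comm, mul_one, one_mul] at h1 h2 h3 h4 h5
  generalize f (a, b) = x1 at *
  generalize f (b, a) = x2 at *
  generalize f (a, a) = x3 at *
  generalize f (a, a * b) = x4 at *
  generalize f (a * b, a) = x5 at *
  generalize f (1, b) = x6 at *
  generalize f (b, 1) = x7 at *
  generalize f (1, 1) = x8 at *
  change QZ at x1 x2 x3 x4 x5 x6 x7 x8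
  grind

lemma klein_cob (K : Klein a b) (hG : ∀ x : G, x = 1 ∨ x = a ∨ x = b ∨ x = a * b)
    (f : groupCohomology.cocycles₂ (Rep.trivial ℤ G QZ)) (hf : f (a, b) = f (b, a)) :
    groupCohomology.H2π _ f = 0 := by
  classical
  rw [groupCohomology.H2π_eq_zero_iff, cob_iff]
  obtain ⟨x, hx⟩ := QZ_half (f (a, a) + f (1, 1))
  obtain ⟨y, hy⟩ := QZ_half (f (b, b) + f (1, 1))
  have c1 : a * b ≠ 1 := fun h => K.ab (by
    have := congrArg (· * b) h
    simpa [mul_assoc, K.bb] using this)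
  have ca : a * b ≠ a := fun h => K.b1 (by simpa using h)
  have cb : a * b ≠ b := fun h => K.a1 (by simpa using h)
  let u : G → QZ := fun g => if g = 1 then f (1, 1) else if g = a then x else
    if g = b then y else x + y - f (a, b)
  have u1 : u 1 = f (1, 1) := by simp [u]
  have ua : u a = x := by simp [u, K.a1]
  have ub : u b = y := by simp [u, K.b1, K.ab.symm]
  have uc : u (a * b) = x + y - f (a, b) := by simp [u, c1, ca, cb]
  have l1 : ∀ g, f (1, g) = f (1, 1) := fun g => by
    have := coc_eq f 1 1 g
    simp only [one_mul] at this
    exact (add_left_cancel this).symm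
  have r1 : ∀ g, f (g, 1) = f (1, 1) := fun g => by
    have := coc_eq f g 1 1
    simp only [mul_one] at this
    exact add_right_cancel this
  have aab : a * (a * b) = b := by rw [← mul_assoc, K.aa, one_mul]
  have bab : b * (a * b) = a := by rw [K.comm, ← mul_assoc, K.bb, one_mul]
  have aba : a * b * a = b := by rw [K.comm, mul_assoc, K.aa, mul_one]
  have abb : a * b * b = a := by rw [mul_assoc, K.bb, mul_one]
  have abab : a * b * (a * b) = 1 := by rw [← mul_assoc, aba, K.bb]
  have h1 := coc_eq f a a b
  have h2 := coc_eq f b a a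
  have h3 := coc_eq f b b a
  have h4 := coc_eq f a b b
  have h5 := coc_eq f a b (a * b)
  simp only [K.aa, K.bb, ← K.comm, mul_one, one_mul, l1, r1, bab] at h1 h2 h3 h4 h5
  refine ⟨u, fun g h => ?_⟩
  rcases hG g with hg | hg | hg | hg <;> rcases hG h with hh | hh | hh | hh <;>
  simp only [hg, hh, K.aa, K.bb, ← K.comm, mul_one, one_mul, l1, r1, bab, aab, aba, abb, abab,
    u1, ua, ub, uc] 
  all_goals (
    clear_value u
    clear u1 ua ub uc l1 r1
    generalize f (a, b) = x1 at *
    generalize f (b, a) = x2 at *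
    generalize f (a, a) = x3 at *
    generalize f (a, a * b) = x4 at *
    generalize f (a * b, a) = x5 at *
    generalize f (b, b) = x6 at *
    generalize f (b, a * b) = x7 at *
    generalize f (a * b, b) = x8 at *
    generalize f (a * b, a * b) = x9 at *
    generalize f (1, 1) = x0 at *
    change QZ at x0 x1 x2 x3 x4 x5 x6 x7 x8 x9
    grind)

/-- The Klein four subgroup. -/
def kleinSub (K : Klein a b) : Subgroup G where
  carrier := {x | x = 1 ∨ x = a ∨ x = b ∨ x = a * b}
  one_mem' := Or.inl rfl
  mul_mem' := by
    have aab : a * (a * b) = b := by rw [← mul_assoc, K.aa, one_mul]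
    have bab : b * (a * b) = a := by rw [K.comm, ← mul_assoc, K.bb, one_mul]
    have aba : a * b * a = b := by rw [K.comm, mul_assoc, K.aa, mul_one]
    have abb : a * b * b = a := by rw [mul_assoc, K.bb, mul_one]
    have abab : a * b * (a * b) = 1 := by rw [← mul_assoc, aba, K.bb]
    rintro x y (hx | hx | hx | hx) (hy | hy | hy | hy) <;>
    simp [hx, hy, K.aa, K.bb, ← K.comm, aab, bab, aba, abb, abab]
  inv_mem' := by
    have aba : a * b * a = b := by rw [K.comm, mul_assoc, K.aa, mul_one]
    have abab : a * b * (a * b) = 1 := by rw [← mul_assoc, aba, K.bb]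
    rintro x (hx | hx | hx | hx) <;> rw [hx, Set.mem_ofPred_eq]
    · simp
    · rw [inv_eq_of_mul_eq_one_left K.aa]; simp
    · rw [inv_eq_of_mul_eq_one_left K.bb]; simp
    · rw [inv_eq_of_mul_eq_one_left abab]; simp

lemma kleinSub_card (K : Klein a b) : Nat.card (kleinSub K) = 4 := by
  have c1 : a * b ≠ 1 := fun h => K.ab (by
    have := congrArg (· * b) h
    simpa [mul_assoc, K.bb] using this)
  have ca : a * b ≠ a := fun h => K.b1 (by simpa using h)
  have cb : a * b ≠ b := fun h => K.a1 (by simpa using h)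
  classical
  have h : ((kleinSub K : Subgroup G) : Set G) = (({1, a, b, a * b} : Finset G) : Set G) := by
    ext x
    simp [kleinSub]
  have h2 : Nat.card (kleinSub K) = Set.ncard ((kleinSub K : Subgroup G) : Set G) := rfl
  rw [h2, h, Set.ncard_coe_finset]
  rw [Finset.card_insert_of_notMem, Finset.card_insert_of_notMem, Finset.card_insert_of_notMem,
    Finset.card_singleton]
  · simpa using cb.symm
  · simpa using ⟨K.ab, K.b1⟩
  · simpa using ⟨K.a1.symm, K.b1.symm, c1.symm⟩

lemma klein_sub_klein (K : Klein a b) :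
    ∃ a' b' : kleinSub K, Klein a' b' ∧ ∀ x, x = 1 ∨ x = a' ∨ x = b' ∨ x = a' * b' := by
  refine ⟨⟨a, Or.inr (Or.inl rfl)⟩, ⟨b, Or.inr (Or.inr (Or.inl rfl))⟩,
    ⟨Subtype.ext K.aa, Subtype.ext K.bb, Subtype.ext K.comm, fun h => K.a1 (congrArg Subtype.val h),
    fun h => K.b1 (congrArg Subtype.val h), fun h => K.ab (congrArg Subtype.val h)⟩, ?_⟩
  rintro ⟨x, hx⟩
  simp only [Subtype.ext_iff]
  exact hx

lemma klein_H2 (K : Klein a b) (hG : ∀ x : G, x = 1 ∨ x = a ∨ x = b ∨ x = a * b)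
    (x y : HZ G QZ 2) : x = 0 ∨ y = 0 ∨ x = y := by
  induction x using groupCohomology.H2_induction_on with | h f => ?_
  induction y using groupCohomology.H2_induction_on with | h g => ?_
  rcases QZ_two _ (klein_tors K f) with hf | hf
  · exact Or.inl (klein_cob K hG f (sub_eq_zero.1 hf))
  rcases QZ_two _ (klein_tors K g) with hg | hg
  · exact Or.inr (Or.inl (klein_cob K hG g (sub_eq_zero.1 hg)))
  refine Or.inr (Or.inr ?_)
  rw [← sub_eq_zero, ← map_sub]
  apply klein_cob K hG
  change (f (a, b) - g (a, b) : QZ) = f (b, a) - g (b, a)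
  have h := hf.trans hg.symm
  rw [sub_eq_sub_iff_add_eq_add] at h ⊢
  rw [h, add_comm]

lemma klein_H3 (K : Klein a b) [Finite G] (hG : ∀ x : G, x = 1 ∨ x = a ∨ x = b ∨ x = a * b)
    (x y : HZ G ℤ 3) : x = 0 ∨ y = 0 ∨ x = y := by
  obtain ⟨e⟩ := shift G
  have := klein_H2 K hG (e.symm x) (e.symm y)
  simpa using this

lemma upper (K : Klein a b) [Finite G]
    (hinj : ∀ x : HZ G ℤ 3, (kleinSub K).index • x = 0 → x = 0)
    (x y : HZ G ℤ 3) : x = 0 ∨ y = 0 ∨ x = y := by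
  obtain ⟨a', b', K', hV⟩ := klein_sub_klein K
  let φ : HZ G ℤ 3 →+ HZ (kleinSub K) ℤ 3 :=
    (groupCohomology.coindIso (Rep.trivial ℤ (kleinSub K) ℤ) 3).toLinearEquiv.toAddEquiv.toAddMonoidHom.comp
      (groupCohomology.map (MonoidHom.id G) (iMap (kleinSub K) ℤ) 3).hom.toAddMonoidHom
  have hφ : Function.Injective φ := by
    rw [injective_iff_map_eq_zero]
    intro z hz
    apply hinj
    apply transfer
    apply (groupCohomology.coindIso (Rep.trivial ℤ (kleinSub K) ℤ) 3).toLinearEquiv.injective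
    rw [map_zero]
    exact hz
  rcases klein_H3 K' hV (φ x) (φ y) with h | h | h
  · exact Or.inl (hφ (by simpa using h))
  · exact Or.inr (Or.inl (hφ (by simpa using h)))
  · exact Or.inr (Or.inr (hφ h))

lemma lower (K : Klein a b) [Finite G] {R : Type} [Ring R] [DecidableEq R] (ρ : G → R)
    (hρ : ∀ g h, ρ g * ρ h = ρ (g * h) ∨ ρ g * ρ h = - ρ (g * h))
    (hne : ∀ g, ρ g ≠ - ρ g) (hab : ρ a * ρ b ≠ ρ b * ρ a) :
    ∃ x : HZ G ℤ 3, x ≠ 0 := by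
  obtain ⟨e⟩ := shift G
  let F : G × G → QZ := fun p => if ρ p.1 * ρ p.2 = ρ (p.1 * p.2) then 0 else hf
  have hF : ∀ g h, (F (g, h) = 0 ∧ ρ g * ρ h = ρ (g * h)) ∨
      (F (g, h) = hf ∧ ρ g * ρ h = - ρ (g * h)) := by
    intro g h
    by_cases h1 : ρ g * ρ h = ρ (g * h)
    · exact Or.inl ⟨if_pos h1, h1⟩
    · exact Or.inr ⟨if_neg h1, (hρ g h).resolve_left h1⟩
  have hne' : ∀ g, - ρ g ≠ ρ g := fun g h => hne g h.symm
  have hc : F ∈ groupCohomology.cocycles₂ (Rep.trivial ℤ G QZ) := by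
    rw [groupCohomology.mem_cocycles₂_iff]
    intro g h j
    change F (g * h, j) + F (g, h) = F (h, j) + F (g, h * j)
    have as : ρ g * ρ h * ρ j = ρ g * (ρ h * ρ j) := mul_assoc _ _ _
    have := hf_add
    rcases hF (g * h) j with ⟨h1, h1'⟩ | ⟨h1, h1'⟩ <;>
    rcases hF g h with ⟨h2, h2'⟩ | ⟨h2, h2'⟩ <;>
    rcases hF h j with ⟨h3, h3'⟩ | ⟨h3, h3'⟩ <;>
    rcases hF g (h * j) with ⟨h4, h4'⟩ | ⟨h4, h4'⟩ <;>
    rw [h1, h2, h3, h4] <;>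
    simp [h2', h3', h1', h4', mul_assoc, hne, hne', this] at as ⊢
  refine ⟨e (groupCohomology.H2π _ ⟨F, hc⟩), ?_⟩
  rw [Ne, EmbeddingLike.map_eq_zero_iff, groupCohomology.H2π_eq_zero_iff]
  intro hb
  obtain ⟨u, hu⟩ := (cob_iff _).1 hb
  have h1 : u b - u (a * b) + u a = F (a, b) := hu a b
  have h2 : u a - u (b * a) + u b = F (b, a) := hu b a
  have h3 : F (a, b) = F (b, a) := by
    rw [← h1, ← h2, K.comm]; abel
  rcases hF a b with ⟨k1, k1'⟩ | ⟨k1, k1'⟩ <;> rcases hF b a with ⟨k2, k2'⟩ | ⟨k2, k2'⟩ <;>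
    rw [k1, k2] at h3
  · exact hab (by rw [k1', k2', K.comm])
  · exact hf_ne h3.symm
  · exact hf_ne h3
  · exact hab (by rw [k1', k2', K.comm])

lemma zmod2_of {A : Type} [AddCommGroup A] (h : ∀ x y : A, x = 0 ∨ y = 0 ∨ x = y)
    (hx : ∃ x : A, x ≠ 0) : Nonempty (A ≃+ ZMod 2) := by
  obtain ⟨x, hx⟩ := hx
  have hu : (Set.univ : Set A) = {0, x} := by
    ext y
    rcases h x y with h | h | h
    · exact absurd h hx
    · simp [h]
    · simp [h]
  have hc : Nat.card A = 2 := by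
    rw [← Set.ncard_univ, hu, Set.ncard_pair hx.symm]
  have : Fact (Nat.Prime 2) := ⟨Nat.prime_two⟩
  have : IsAddCyclic A := isAddCyclic_of_prime_card hc
  exact ⟨addEquivOfAddCyclicCardEq (hc.trans (Nat.card_zmod 2).symm)⟩
end V

end AltCoh
namespace AltCoh
abbrev M5 := Matrix (Fin 2) (Fin 2) (ZMod 5)

/-- Matrices of the Klein four group, indexed by the image of the last point. -/
def wMat : ℕ → M5
  | 3 => 1
  | 2 => !![4, 3; 1, 1]
  | 1 => !![3, 0; 2, 2]
  | _ => !![4, 3; 1, 1] * !![3, 0; 2, 2]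

def wAct : ℕ → ℕ → ℕ
  | 3, x => x
  | 2, x => ![1, 0, 3, 2] (Fin.ofNat 4 x)
  | 1, x => ![2, 3, 0, 1] (Fin.ofNat 4 x)
  | _, x => ![3, 2, 1, 0] (Fin.ofNat 4 x)

def r4 (x y : ℕ) : M5 := wMat y * !![0, 2; 2, 1] ^ (wAct y x)

def rho4 (g : Alt 4) : M5 := r4 (g.1 0) (g.1 3)

def rho5 (g : Alt 5) : M5 :=
  !![1, ((g.1 4).val : ZMod 5) + 1; 0, 1] * r4 (g.1 0 - (g.1 4 + 1) : Fin 5) (g.1 3 - (g.1 4 + 1) : Fin 5)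

def perm {n : ℕ} (f g : Fin n → Fin n) (h1 : ∀ x, g (f x) = x) (h2 : ∀ x, f (g x) = x) :
  Equiv.Perm (Fin n) := ⟨f, g, h1, h2⟩

def a4 : Alt 4 := ⟨perm ![1,0,3,2] ![1,0,3,2] (by decide) (by decide), Equiv.Perm.mem_alternatingGroup.2 (by decide)⟩
def b4 : Alt 4 := ⟨perm ![2,3,0,1] ![2,3,0,1] (by decide) (by decide), Equiv.Perm.mem_alternatingGroup.2 (by decide)⟩
def d4 : Alt 4 := ⟨perm ![1,2,0,3] ![2,0,1,3] (by decide) (by decide), Equiv.Perm.mem_alternatingGroup.2 (by decide)⟩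
def a5 : Alt 5 := ⟨perm ![1,0,3,2,4] ![1,0,3,2,4] (by decide) (by decide), Equiv.Perm.mem_alternatingGroup.2 (by decide)⟩
def b5 : Alt 5 := ⟨perm ![2,3,0,1,4] ![2,3,0,1,4] (by decide) (by decide), Equiv.Perm.mem_alternatingGroup.2 (by decide)⟩
def d5 : Alt 5 := ⟨perm ![1,2,0,3,4] ![2,0,1,3,4] (by decide) (by decide), Equiv.Perm.mem_alternatingGroup.2 (by decide)⟩
def c5 : Alt 5 := ⟨perm ![1,2,3,4,0] ![4,0,1,2,3] (by decide) (by decide), Equiv.Perm.mem_alternatingGroup.2 (by decide)⟩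

set_option maxRecDepth 100000
lemma rho4_mul : ∀ g h : Alt 4, rho4 g * rho4 h = rho4 (g * h) ∨ rho4 g * rho4 h = - rho4 (g * h) := by
  decide +kernel

lemma rho4_ne : ∀ g : Alt 4, rho4 g ≠ - rho4 g := by
  decide +kernel

lemma rho5_ne : ∀ g : Alt 5, rho5 g ≠ - rho5 g := by
  decide +kernel
def Good (g : Alt 5) : Prop := ∀ h : Alt 5, rho5 g * rho5 h = rho5 (g * h) ∨ rho5 g * rho5 h = - rho5 (g * h)
lemma good_a : Good a5 := by unfold Good; decide +kernel
lemma good_b : Good b5 := by unfold Good; decide +kernel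
lemma good_c : Good c5 := by unfold Good; decide +kernel
lemma good_d : Good d5 := by unfold Good; decide +kernel

lemma normal5 : ∀ g : Alt 5, ∃ i : Fin 5, ∃ k l : Fin 2, ∃ j : Fin 3,
    g = c5 ^ i.1 * (a5 ^ k.1 * (b5 ^ l.1 * d5 ^ j.1)) := by decide +kernel
end AltCoh

namespace AltCoh
lemma sign_aux {R : Type} [Ring R] {a b c d e f : R} (e1 : a * b = d ∨ a * b = -d)
    (e2 : b * c = e ∨ b * c = -e) (e3 : a * e = f ∨ a * e = -f) : d * c = f ∨ d * c = -f := by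
  have h4 : a * b * c = a * (b * c) := mul_assoc _ _ _
  rcases e1 with e1 | e1 <;> rcases e2 with e2 | e2 <;> rcases e3 with e3 | e3 <;>
    rw [e1, e2] at h4 <;> simp only [neg_mul, mul_neg, e3, neg_neg, neg_inj] at h4 <;>
    first
    | exact Or.inl h4
    | exact Or.inr h4
    | exact Or.inr (by rw [← h4, neg_neg])
    | exact Or.inl (by rw [← neg_inj, h4])

lemma good_mul {g k : Alt 5} (hg : Good g) (hk : Good k) : Good (g * k) := by
  intro h
  have e1 := hg k
  have e2 := hk h
  have e3 := hg (k * h)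
  rw [← mul_assoc g k h] at e3
  exact sign_aux e1 e2 e3

lemma good_one : Good 1 := by unfold Good; decide +kernel

lemma good_pow {g : Alt 5} (hg : Good g) (n : ℕ) : Good (g ^ n) := by
  induction n with
  | zero => rw [pow_zero]; exact good_one
  | succ n ih => rw [pow_succ]; exact good_mul ih hg

lemma good_all (g : Alt 5) : Good g := by
  obtain ⟨i, k, l, j, e⟩ := normal5 g
  rw [e]
  exact good_mul (good_pow good_c _) (good_mul (good_pow good_a _)
    (good_mul (good_pow good_b _) (good_pow good_d _)))

lemma K4 : Klein a4 b4 := ⟨by decide +kernel, by decide +kernel, by decide +kernel,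
  by decide +kernel, by decide +kernel, by decide +kernel⟩
lemma K5 : Klein a5 b5 := ⟨by decide +kernel, by decide +kernel, by decide +kernel,
  by decide +kernel, by decide +kernel, by decide +kernel⟩

lemma nc4 : rho4 a4 * rho4 b4 ≠ rho4 b4 * rho4 a4 := by decide +kernel
lemma nc5 : rho5 a5 * rho5 b5 ≠ rho5 b5 * rho5 a5 := by decide +kernel

lemma card4 : Nat.card (Alt 4) = 12 := by
  rw [nat_card_alternatingGroup]; simp [Nat.factorial]
lemma card5 : Nat.card (Alt 5) = 60 := by
  rw [nat_card_alternatingGroup]; simp [Nat.factorial]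

lemma index_zpowers {G : Type} [Group G] {g : G} {p m : ℕ} [hp : Fact p.Prime]
    (h : g ^ p = 1) (h1 : g ≠ 1) (hc : Nat.card G = p * m) : (Subgroup.zpowers g).index = m := by
  have e := (Subgroup.zpowers g).card_mul_index
  rw [Nat.card_zpowers, orderOf_eq_prime h h1, hc] at e
  exact Nat.eq_of_mul_eq_mul_left hp.out.pos e

lemma smul_gcd {A : Type} [AddCommGroup A] {x : A} {m n : ℕ} (hm : m • x = 0) (hn : n • x = 0) :
    Nat.gcd m n • x = 0 := by
  rw [← addOrderOf_dvd_iff_nsmul_eq_zero] at *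
  exact Nat.dvd_gcd hm hn

lemma hinj4 (x : HZ (Alt 4) ℤ 3) (h : (kleinSub K4).index • x = 0) : x = 0 := by
  have e := (kleinSub K4).card_mul_index
  rw [kleinSub_card, card4] at e
  have e' : (kleinSub K4).index = 3 := by omega
  rw [e'] at h
  have := Nat.fact_prime_three
  have h2 := cyc_index d4 x
  rw [index_zpowers (p := 3) (m := 4) (by decide +kernel) (by decide +kernel) card4] at h2
  simpa using smul_gcd h h2

lemma hinj5 (x : HZ (Alt 5) ℤ 3) (h : (kleinSub K5).index • x = 0) : x = 0 := by
  have e := (kleinSub K5).card_mul_index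
  rw [kleinSub_card, card5] at e
  have e' : (kleinSub K5).index = 15 := by omega
  rw [e'] at h
  have := Nat.fact_prime_three
  have : Fact (Nat.Prime 5) := ⟨by norm_num⟩
  have h2 := cyc_index d5 x
  rw [index_zpowers (p := 3) (m := 20) (by decide +kernel) (by decide +kernel) card5] at h2
  have h3 := cyc_index c5 x
  rw [index_zpowers (p := 5) (m := 12) (by decide +kernel) (by decide +kernel) card5] at h3
  simpa using smul_gcd (smul_gcd h h2) h3

def d3 : Alt 3 := ⟨perm ![1,2,0] ![2,0,1] (by decide) (by decide),
  Equiv.Perm.mem_alternatingGroup.2 (by decide)⟩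

lemma gen3 : ∀ x : Alt 3, ∃ k : Fin 3, d3 ^ k.1 = x := by decide +kernel

end AltCoh

/-- `H³(𝔄₃, ℤ_triv) = 0`, `H³(𝔄₄, ℤ_triv) ≅ ℤ/2ℤ` and `H³(𝔄₅, ℤ_triv) ≅ ℤ/2ℤ`. -/
theorem stmt_3 :
    Subsingleton (groupCohomology (Rep.trivial ℤ (Alt 3) ℤ) 3) ∧
    Nonempty ((groupCohomology (Rep.trivial ℤ (Alt 4) ℤ) 3) ≃+ ZMod 2) ∧
    Nonempty ((groupCohomology (Rep.trivial ℤ (Alt 5) ℤ) 3) ≃+ ZMod 2) := by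
  refine ⟨AltCoh.cyc_zero AltCoh.d3 fun x => ?_, AltCoh.zmod2_of ?_ ?_, AltCoh.zmod2_of ?_ ?_⟩
  · obtain ⟨k, rfl⟩ := AltCoh.gen3 x
    exact Subgroup.npow_mem_zpowers _ _
  · exact AltCoh.upper AltCoh.K4 AltCoh.hinj4
  · exact AltCoh.lower AltCoh.K4 AltCoh.rho4 AltCoh.rho4_mul AltCoh.rho4_ne AltCoh.nc4
  · exact AltCoh.upper AltCoh.K5 AltCoh.hinj5
  · exact AltCoh.lower AltCoh.K5 AltCoh.rho5 AltCoh.good_all AltCoh.rho5_ne AltCoh.nc5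
end
end

section
/- For every integer m ≥ 2, the first group cohomology of the symmetric group 𝔖_m with coefficients in the sign module ℤ_sgn satisfies H^1(𝔖_m, ℤ_sgn) ≅ ℤ/2ℤ. -/
open CategoryTheory

noncomputable section

/-- The sign module `ℤ_sgn` of the symmetric group `𝔖ₘ`: the underlying abelian group is `ℤ`,
and a permutation `σ` acts as multiplication by its sign `sgn(σ) ∈ {±1}`. -/
def signRep (m : ℕ) : Representation ℤ (Equiv.Perm (Fin m)) ℤ where
  toFun σ := ((Equiv.Perm.sign σ : ℤˣ) : ℤ) • LinearMap.id
  map_one' := by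
    ext
    simp
  map_mul' := by
    intro σ τ
    ext
    simp [map_mul, Units.val_mul, mul_smul]

lemma signRep_apply' (m : ℕ) (σ : Equiv.Perm (Fin m)) (x : ℤ) :
    signRep m σ x = ((Equiv.Perm.sign σ : ℤˣ) : ℤ) * x := by
  simp [signRep]

lemma coc_mul (m : ℕ) (f : Equiv.Perm (Fin m) → ℤ)
    (hf : f ∈ groupCohomology.cocycles₁ (Rep.of (signRep m))) (g h : Equiv.Perm (Fin m)) :
    f (g * h) = ((Equiv.Perm.sign g : ℤˣ) : ℤ) * f h + f g := by
  have := (groupCohomology.mem_cocycles₁_iff (A := Rep.of (signRep m)) f).1 hf g h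
  rw [← signRep_apply']
  exact this

lemma coc_even (m : ℕ) (f : Equiv.Perm (Fin m) → ℤ)
    (hf : ∀ g h, f (g * h) = ((Equiv.Perm.sign g : ℤˣ) : ℤ) * f h + f g)
    (g : Equiv.Perm (Fin m)) (hg : Equiv.Perm.sign g = 1) : f g = 0 := by
  have h1 : f 1 = 0 := by
    have := hf 1 1
    simp at this
    exact this
  have hn : ∀ n : ℕ, f (g ^ n) = n * f g := by
    intro n
    induction n with
    | zero => simp [h1]
    | succ n ih =>
      rw [pow_succ', hf, ih, hg]
      push_cast
      ring
  have h2 := hn (orderOf g)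
  rw [pow_orderOf_eq_one, h1] at h2
  have h3 : (orderOf g : ℤ) ≠ 0 := by
    exact_mod_cast (orderOf_pos g).ne'
  rcases mul_eq_zero.1 h2.symm with h | h
  · exact absurd h h3
  · exact h

lemma coc_odd (m : ℕ) (f : Equiv.Perm (Fin m) → ℤ)
    (hf : ∀ g h, f (g * h) = ((Equiv.Perm.sign g : ℤˣ) : ℤ) * f h + f g)
    (g t : Equiv.Perm (Fin m)) (hg : Equiv.Perm.sign g = -1) (ht : Equiv.Perm.sign t = -1) :
    f g = f t := by
  have h := coc_even m f hf (g * t) (by simp [hg, ht])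
  rw [hf, hg] at h
  simp at h
  linarith

/-- For every integer `m ≥ 2`, `H¹(𝔖ₘ, ℤ_sgn) ≅ ℤ/2ℤ`. -/
theorem stmt_14 (m : ℕ) (hm : 2 ≤ m) :
    Nonempty ((groupCohomology (Rep.of (signRep m)) 1) ≃+ ZMod 2) := by
  classical
  let A := Rep.of (signRep m)
  let t : Equiv.Perm (Fin m) := Equiv.swap ⟨0, by omega⟩ ⟨1, by omega⟩
  have ht : Equiv.Perm.sign t = -1 := Equiv.Perm.sign_swap (by simp)
  let p : groupCohomology.cocycles₁ A →+ groupCohomology A 1 :=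
    (groupCohomology.H1π A).hom.toAddMonoidHom
  have hp : Function.Surjective p :=
    (ModuleCat.epi_iff_surjective (groupCohomology.H1π A)).1 inferInstance
  let e : groupCohomology.cocycles₁ A →+ ZMod 2 :=
    { toFun := fun f => (((f : Equiv.Perm (Fin m) → ℤ) t : ℤ) : ZMod 2)
      map_zero' := Int.cast_zero
      map_add' := fun f g => Int.cast_add _ _ }
  have he : Function.Surjective e := by
    have hc : (fun g => if Equiv.Perm.sign g = 1 then (0:ℤ) else 1 : Equiv.Perm (Fin m) → ℤ)
        ∈ groupCohomology.cocycles₁ A := by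
      refine (groupCohomology.mem_cocycles₁_iff (A := Rep.of (signRep m)) _).2 ?_
      intro g h
      change _ = signRep m g _ + _
      rw [signRep_apply']
      rcases Int.units_eq_one_or (Equiv.Perm.sign g) with h1 | h1 <;>
      rcases Int.units_eq_one_or (Equiv.Perm.sign h) with h2 | h2 <;>
      simp [h1, h2]
    have h1 : e ⟨_, hc⟩ = 1 := by
      change (((if Equiv.Perm.sign t = 1 then (0:ℤ) else 1 : ℤ)) : ZMod 2) = 1
      simp [ht]
    intro z
    refine ⟨z.val • ⟨_, hc⟩, ?_⟩
    rw [map_nsmul, h1]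
    simp
  have hk : p.ker = e.ker := by
    ext f
    rw [AddMonoidHom.mem_ker, AddMonoidHom.mem_ker]
    have hf := coc_mul m f.1 f.2
    refine (groupCohomology.H1π_eq_zero_iff (A := A) f).trans ?_
    change _ ↔ ((f.1 t : ℤ) : ZMod 2) = 0
    rw [ZMod.intCast_zmod_eq_zero_iff_dvd]
    constructor
    · rintro ⟨x, hx⟩
      have h2 : signRep m t x - x = f.1 t := congrFun hx t
      rw [signRep_apply', ht] at h2
      refine ⟨-x, ?_⟩
      rw [← h2]
      push_cast
      ring
    · rintro ⟨x, hx⟩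
      refine ⟨(-x : ℤ), ?_⟩
      funext g
      change signRep m g (-x) - (-x) = f.1 g
      rw [signRep_apply']
      rcases Int.units_eq_one_or (Equiv.Perm.sign g) with h1 | h1
      · rw [coc_even m f.1 hf g h1, h1]
        simp
      · rw [coc_odd m f.1 hf g t h1 ht, hx, h1]
        push_cast
        ring
  exact ⟨(QuotientAddGroup.quotientKerEquivOfSurjective p hp).symm.trans
    ((QuotientAddGroup.quotientAddEquivOfEq hk).trans
      (QuotientAddGroup.quotientKerEquivOfSurjective e he))⟩
end
end
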